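/- arXiv:1805.05436 — 13 statements merged into one kernel-verified Lean document; each statement's English description precedes it below -/
import Mathlib

section
/- (Theorem: greedy is 3-competitive.) For every number of machines m ≥ 2 and for every instance σ of the uniform profit case on m machines, the optimal offline profit is at most three times the profit of the greedy algorithm: OPT(σ) ≤ 3 · V_GR(σ). -/
open MeasureTheory

/- A job is a pair `(r, d)` of reals with `r < d`, representing the closed
interval `[r, d]`.  An instance on `m` machines is a nonempty finite sequence
`jobs : Fin n → ℝ × ℝ` of such jobs.  A placement is `f : Fin n → Fin m`. -/

/-- Profit of a placement in the uniform profit case: the sum over machines of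
the Lebesgue measure of the union of the intervals of the jobs placed there. -/
noncomputable def profit {n m : ℕ} (jobs : Fin n → ℝ × ℝ) (f : Fin n → Fin m) : ℝ :=
  ∑ a : Fin m,
    (volume (⋃ i : Fin n, ⋃ (_ : f i = a), Set.Icc (jobs i).1 (jobs i).2)).toReal

/-- Optimal offline profit. -/
noncomputable def opt (m : ℕ) {n : ℕ} (jobs : Fin n → ℝ × ℝ) : ℝ :=
  ⨆ f : Fin n → Fin m, profit jobs f

/-- Marginal gain of placing job `i` onto machine `a`, given that earlier jobs
`j < i` were placed according to `g`. -/
noncomputable def gain {n m : ℕ} (jobs : Fin n → ℝ × ℝ) (g : Fin n → Fin m)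
    (i : Fin n) (a : Fin m) : ℝ :=
  (volume (Set.Icc (jobs i).1 (jobs i).2 \
      ⋃ j : Fin n, ⋃ (_ : j < i ∧ g j = a), Set.Icc (jobs j).1 (jobs j).2)).toReal

/-- `g` is the greedy placement: each job is placed onto a machine maximizing
the marginal gain, ties broken in favor of the smallest machine index. -/
def IsGreedy {n m : ℕ} (jobs : Fin n → ℝ × ℝ) (g : Fin n → Fin m) : Prop :=
  ∀ i : Fin n,
    (∀ b : Fin m, gain jobs g i b ≤ gain jobs g i (g i)) ∧
    (∀ b : Fin m, gain jobs g i b = gain jobs g i (g i) → g i ≤ b)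

/-- The union of the jobs satisfying a predicate is compact. -/
theorem isCompact_iUnion_jobs {n : ℕ} (jobs : Fin n → ℝ × ℝ) (p : Fin n → Prop) :
    IsCompact (⋃ i : Fin n, ⋃ (_ : p i), Set.Icc (jobs i).1 (jobs i).2) :=
  isCompact_iUnion fun _ => isCompact_iUnion fun _ => isCompact_Icc

/-- The marginal gains collected by a placement add up to at most its profit. -/
theorem sum_gain_le_profit {n m : ℕ} (jobs : Fin n → ℝ × ℝ) (g : Fin n → Fin m) :
    ∑ i, gain jobs g i (g i) ≤ profit jobs g := by
  rw [← Finset.sum_fiberwise Finset.univ g (fun i => gain jobs g i (g i))]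
  refine Finset.sum_le_sum fun a _ => ?_
  set D : Fin n → Set ℝ := fun i => Set.Icc (jobs i).1 (jobs i).2 \
      ⋃ j : Fin n, ⋃ (_ : j < i ∧ g j = a), Set.Icc (jobs j).1 (jobs j).2
  have hmeas : ∀ i, MeasurableSet (D i) := fun i =>
    measurableSet_Icc.diff (isCompact_iUnion_jobs jobs _).measurableSet
  have hfin : ∀ i, volume (D i) ≠ ⊤ := fun i =>
    measure_ne_top_of_subset Set.sdiff_subset isCompact_Icc.measure_lt_top.ne
  have hdisj_lt : ∀ i j, g i = a → i < j → Disjoint (D i) (D j) := by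
    intro i j hi hij
    refine Set.disjoint_left.2 fun x hx hx' => hx'.2 ?_
    exact Set.mem_iUnion₂.2 ⟨i, ⟨hij, hi⟩, hx.1⟩
  have hdisj : Set.PairwiseDisjoint
      (Finset.univ.filter fun i => g i = a : Finset (Fin n)) D := by
    intro i hi j hj hij
    simp only [Finset.coe_filter, Finset.mem_univ, true_and, Set.mem_ofPred_eq] at hi hj
    rcases lt_or_gt_of_ne hij with h | h
    · exact hdisj_lt i j hi h
    · exact (hdisj_lt j i hj h).symm
  calc ∑ i with g i = a, gain jobs g i (g i)
      = ∑ i with g i = a, volume.real (D i) := by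
        refine Finset.sum_congr rfl fun i hi => ?_
        rw [(Finset.mem_filter.1 hi).2]
        rfl
    _ = volume.real (⋃ i ∈ Finset.univ.filter fun i => g i = a, D i) :=
        (measureReal_biUnion_finset hdisj (fun i _ => hmeas i) (fun i _ => hfin i)).symm
    _ ≤ _ := by
        refine measureReal_mono ?_ (isCompact_iUnion_jobs jobs _).measure_lt_top.ne
        refine Set.iUnion₂_subset fun i hi x hx => ?_
        exact Set.mem_iUnion₂.2 ⟨i, (Finset.mem_filter.1 hi).2, hx.1⟩

/-- Any placement earns at most the profit of `g` plus the marginal gains that its jobs would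
have had, on the machines it selects, at their arrival in the run of `g`. -/
theorem profit_le_profit_add_sum_gain {n m : ℕ} (jobs : Fin n → ℝ × ℝ)
    (f g : Fin n → Fin m) :
    profit jobs f ≤ profit jobs g + ∑ i, gain jobs g i (f i) := by
  rw [← Finset.sum_fiberwise Finset.univ f (fun i => gain jobs g i (f i)), profit, profit,
    ← Finset.sum_add_distrib]
  refine Finset.sum_le_sum fun a _ => ?_
  set D : Fin n → Set ℝ := fun i => Set.Icc (jobs i).1 (jobs i).2 \
      ⋃ j : Fin n, ⋃ (_ : j < i ∧ g j = a), Set.Icc (jobs j).1 (jobs j).2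
  set A : Set ℝ := ⋃ i : Fin n, ⋃ (_ : g i = a), Set.Icc (jobs i).1 (jobs i).2
  have hfin : ∀ i, volume (D i) ≠ ⊤ := fun i =>
    measure_ne_top_of_subset Set.sdiff_subset isCompact_Icc.measure_lt_top.ne
  have hsum : ∑ i with f i = a, gain jobs g i (f i) = ∑ i with f i = a, volume.real (D i) := by
    refine Finset.sum_congr rfl fun i hi => ?_
    rw [(Finset.mem_filter.1 hi).2]
    rfl
  rw [hsum]
  have hAfin : volume A ≠ ⊤ := (isCompact_iUnion_jobs jobs _).measure_lt_top.ne
  have hDfin : volume (⋃ i ∈ Finset.univ.filter fun i => f i = a, D i) ≠ ⊤ :=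
    (measure_biUnion_lt_top (Finset.finite_toSet _) fun i _ => (hfin i).lt_top).ne
  calc volume.real (⋃ i : Fin n, ⋃ (_ : f i = a), Set.Icc (jobs i).1 (jobs i).2)
      ≤ volume.real (A ∪ ⋃ i ∈ Finset.univ.filter fun i => f i = a, D i) := by
        refine measureReal_mono ?_ (measure_union_ne_top hAfin hDfin)
        refine Set.iUnion₂_subset fun i hi x hx => ?_
        by_cases hxA : x ∈ A
        · exact Or.inl hxA
        · refine Or.inr (Set.mem_iUnion₂.2 ⟨i, by simpa using hi, hx, fun h => hxA ?_⟩)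
          obtain ⟨j, hj, hxj⟩ := Set.mem_iUnion₂.1 h
          exact Set.mem_iUnion₂.2 ⟨j, hj.2, hxj⟩
    _ ≤ volume.real A + volume.real (⋃ i ∈ Finset.univ.filter fun i => f i = a, D i) :=
        measureReal_union_le _ _
    _ ≤ volume.real A + ∑ i with f i = a, volume.real (D i) := by
        gcongr
        exact measureReal_biUnion_finset_le _ _

theorem profit_nonneg {n m : ℕ} (jobs : Fin n → ℝ × ℝ) (f : Fin n → Fin m) :
    0 ≤ profit jobs f :=
  Finset.sum_nonneg fun _ _ => ENNReal.toReal_nonneg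

/-- Greedy is 3-competitive: for every `m ≥ 2` and every instance of the
uniform profit case, `OPT(σ) ≤ 3 · V_GR(σ)`. -/
theorem greedy_three_competitive (m : ℕ) (hm : 2 ≤ m) (n : ℕ) (hn : 0 < n)
    (jobs : Fin n → ℝ × ℝ) (hjobs : ∀ i, (jobs i).1 < (jobs i).2)
    (g : Fin n → Fin m) (hg : IsGreedy jobs g) :
    opt m jobs ≤ 3 * profit jobs g := by
  have : Nonempty (Fin n → Fin m) := ⟨g⟩
  refine ciSup_le fun f => ?_
  have h_exchange := profit_le_profit_add_sum_gain jobs f g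
  have h_greedy : ∑ i, gain jobs g i (f i) ≤ ∑ i, gain jobs g i (g i) :=
    Finset.sum_le_sum fun i _ => (hg i).1 (f i)
  have h_gain := sum_gain_le_profit jobs g
  have h_nonneg := profit_nonneg jobs g
  linarith
end

section
/- (Theorem: greedy is 4/3-competitive on two machines.) For m = 2 machines and for every instance σ of the uniform profit case, OPT(σ) ≤ (4/3) · V_GR(σ). -/
open MeasureTheory

/-- The points covered by the jobs among the first `k` that `g` places on machine `a`. -/
def coveredBy {α : Type*} {n m : ℕ} (J : Fin n → Set α) (g : Fin n → Fin m) (k : ℕ)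
    (a : Fin m) : Set α :=
  {x | ∃ j : Fin n, (j : ℕ) < k ∧ g j = a ∧ x ∈ J j}

/-- The points lying in at least two of the first `k` jobs. -/
def multiplyCovered {α : Type*} {n : ℕ} (J : Fin n → Set α) (k : ℕ) : Set α :=
  {x | ∃ i j : Fin n, i < j ∧ (j : ℕ) < k ∧ x ∈ J i ∧ x ∈ J j}

section Covering

variable {α : Type*} {n m : ℕ} (J : Fin n → Set α)

lemma coveredBy_eq_iUnion (g : Fin n → Fin m) (k : ℕ) (a : Fin m) :
    coveredBy J g k a = ⋃ j : Fin n, ⋃ (_ : (j : ℕ) < k ∧ g j = a), J j := by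
  ext x
  simp [coveredBy, and_assoc]

lemma coveredBy_length (g : Fin n → Fin m) (a : Fin m) :
    coveredBy J g n a = ⋃ j : Fin n, ⋃ (_ : g j = a), J j := by
  simp [coveredBy_eq_iUnion]

lemma coveredBy_succ_self (g : Fin n → Fin m) (i : Fin n) :
    coveredBy J g (i + 1) (g i) = coveredBy J g i (g i) ∪ J i := by
  ext x
  constructor
  · rintro ⟨j, hj, hja, hx⟩
    rcases Nat.lt_succ_iff_lt_or_eq.1 hj with h | h
    · exact .inl ⟨j, h, hja, hx⟩
    · exact .inr (Fin.ext h ▸ hx)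
  · rintro (⟨j, hj, hja, hx⟩ | hx)
    · exact ⟨j, by omega, hja, hx⟩
    · exact ⟨i, by omega, rfl, hx⟩

lemma coveredBy_succ_of_ne (g : Fin n → Fin m) (i : Fin n) {a : Fin m} (ha : g i ≠ a) :
    coveredBy J g (i + 1) a = coveredBy J g i a := by
  ext x
  constructor
  · rintro ⟨j, hj, hja, hx⟩
    rcases Nat.lt_succ_iff_lt_or_eq.1 hj with h | h
    · exact ⟨j, h, hja, hx⟩
    · exact absurd (Fin.ext h ▸ hja) ha
  · rintro ⟨j, hj, hja, hx⟩
    exact ⟨j, by omega, hja, hx⟩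

lemma multiplyCovered_succ_subset (g : Fin n → Fin 2) (i : Fin n) :
    multiplyCovered J (i + 1) ⊆
      multiplyCovered J i ∪ J i ∩ (coveredBy J g i 0 ∪ coveredBy J g i 1) := by
  rintro x ⟨p, q, hpq, hq, hxp, hxq⟩
  rcases Nat.lt_succ_iff_lt_or_eq.1 hq with h | h
  · exact .inl ⟨p, q, hpq, h, hxp, hxq⟩
  · obtain rfl : q = i := Fin.ext h
    refine .inr ⟨hxq, ?_⟩
    rcases Fin.exists_fin_two.1 ⟨g p, rfl⟩ with h0 | h1
    · exact .inl ⟨p, hpq, h0, hxp⟩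
    · exact .inr ⟨p, hpq, h1, hxp⟩

lemma coveredBy_inter_subset_multiplyCovered (f : Fin n → Fin m) {a b : Fin m} (hab : a ≠ b) :
    coveredBy J f n a ∩ coveredBy J f n b ⊆ multiplyCovered J n := by
  rintro x ⟨⟨i, -, hi, hxi⟩, ⟨j, -, hj, hxj⟩⟩
  have hij : i ≠ j := by
    rintro rfl
    exact hab (hi.symm.trans hj)
  rcases hij.lt_or_gt with h | h
  · exact ⟨i, j, h, j.2, hxi, hxj⟩
  · exact ⟨j, i, h, i.2, hxj, hxi⟩

lemma coveredBy_union_eq_iUnion (f : Fin n → Fin 2) :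
    coveredBy J f n 0 ∪ coveredBy J f n 1 = ⋃ i, J i := by
  ext x
  simp only [coveredBy, Set.mem_union, Set.mem_ofPred_eq, Set.mem_iUnion]
  constructor
  · rintro (⟨i, -, -, hx⟩ | ⟨i, -, -, hx⟩) <;> exact ⟨i, hx⟩
  · rintro ⟨i, hx⟩
    rcases Fin.exists_fin_two.1 ⟨f i, rfl⟩ with h | h
    · exact .inl ⟨i, i.2, h, hx⟩
    · exact .inr ⟨i, i.2, h, hx⟩

lemma multiplyCovered_subset_iUnion (k : ℕ) : multiplyCovered J k ⊆ ⋃ i, J i :=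
  fun _ ⟨i, _, _, _, hx, _⟩ => Set.mem_iUnion.2 ⟨i, hx⟩

end Covering

section Measure

variable {α : Type*} [MeasurableSpace α] {μ : Measure α}

/-- Adding a set `J` to `A` rather than to `B`, when this has the larger marginal gain, keeps
the multiply covered points missed by `A ∩ B` of measure at most that of `A ∩ B`. -/
lemma measureReal_missed_le_of_gain_le {A B D D' J : Set α}
    (hA : MeasurableSet A) (hB : MeasurableSet B) (hJ : MeasurableSet J)
    (hAf : μ A ≠ ⊤) (hBf : μ B ≠ ⊤) (hJf : μ J ≠ ⊤) (hDf : μ D ≠ ⊤)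
    (hD' : D' ⊆ D ∪ J ∩ (A ∪ B)) (hgain : μ.real (J \ B) ≤ μ.real (J \ A))
    (h : μ.real (D \ (A ∩ B)) ≤ μ.real (A ∩ B)) :
    μ.real (D' \ ((A ∪ J) ∩ B)) ≤ μ.real ((A ∪ J) ∩ B) := by
  have fin_of {s t : Set α} (hst : s ⊆ t) (ht : μ t ≠ ⊤) : μ s ≠ ⊤ :=
    measure_ne_top_of_subset hst ht
  have hsub : D' \ ((A ∪ J) ∩ B) ⊆ (D \ (A ∩ B)) ∪ (J \ B) ∩ A := by
    intro x hx
    have := @hD' x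
    simp only [Set.mem_sdiff, Set.mem_inter_iff, Set.mem_union] at *
    tauto
  have hsplit : (A ∪ J) ∩ B = (A ∩ B) ∪ (J \ A) ∩ B := by
    ext x
    simp only [Set.mem_sdiff, Set.mem_inter_iff, Set.mem_union]
    tauto
  have hdisj : Disjoint (A ∩ B) ((J \ A) ∩ B) :=
    Set.disjoint_left.2 fun x hx hx' => hx'.1.2 hx.1
  have hnew : μ.real ((A ∪ J) ∩ B) = μ.real (A ∩ B) + μ.real ((J \ A) ∩ B) := by
    rw [hsplit]
    exact measureReal_union hdisj ((hJ.diff hA).inter hB)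
      (fin_of Set.inter_subset_left hAf) (fin_of Set.inter_subset_right hBf)
  have hmono : μ.real (D' \ ((A ∪ J) ∩ B)) ≤ μ.real (D \ (A ∩ B)) + μ.real ((J \ B) ∩ A) :=
    (measureReal_mono hsub (measure_union_ne_top (fin_of Set.sdiff_subset hDf)
      (fin_of Set.inter_subset_right hAf))).trans (measureReal_union_le _ _)
  have h1 := measureReal_inter_add_sdiff (μ := μ) (s := J \ B) hA (fin_of Set.sdiff_subset hJf)
  have h2 := measureReal_inter_add_sdiff (μ := μ) (s := J \ A) hB (fin_of Set.sdiff_subset hJf)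
  have hcomm : (J \ B) \ A = (J \ A) \ B := Set.sdiff_sdiff_comm
  rw [hcomm] at h1
  linarith

/-- If `A` and `B` have the same union as `P` and `Q`, and the points of `P ∩ Q` missed by
`A ∩ B` have measure at most that of `A ∩ B`, then `A` and `B` cover at least three quarters
of what `P` and `Q` do. -/
lemma measureReal_add_le_four_thirds_mul {A B P Q D : Set α}
    (hB : MeasurableSet B) (hQ : MeasurableSet Q)
    (hAf : μ A ≠ ⊤) (hBf : μ B ≠ ⊤) (hPf : μ P ≠ ⊤) (hQf : μ Q ≠ ⊤)
    (hAm : MeasurableSet A) (hunion : P ∪ Q = A ∪ B) (hPQ : P ∩ Q ⊆ D) (hD : D ⊆ A ∪ B)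
    (h : μ.real (D \ (A ∩ B)) ≤ μ.real (A ∩ B)) :
    μ.real P + μ.real Q ≤ 4 / 3 * (μ.real A + μ.real B) := by
  have hU : μ (A ∪ B) ≠ ⊤ := measure_union_ne_top hAf hBf
  have hDf : μ D ≠ ⊤ := measure_ne_top_of_subset hD hU
  have hPQadd := measureReal_union_add_inter (μ := μ) (s := P) hQ hPf hQf
  have hABadd := measureReal_union_add_inter (μ := μ) (s := A) hB hAf hBf
  have hPQle : μ.real (P ∩ Q) ≤ μ.real D := measureReal_mono hPQ hDf
  have hDsplit := measureReal_inter_add_sdiff (μ := μ) (s := D) (hAm.inter hB) hDf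
  have hDle : μ.real (D ∩ (A ∩ B)) ≤ μ.real (A ∩ B) :=
    measureReal_mono Set.inter_subset_right (measure_ne_top_of_subset Set.inter_subset_left hAf)
  have hUsplit := measureReal_inter_add_sdiff (μ := μ) (s := A ∪ B) (hAm.inter hB) hU
  have hUinter : (A ∪ B) ∩ (A ∩ B) = A ∩ B :=
    Set.inter_eq_right.2 (Set.inter_subset_left.trans Set.subset_union_left)
  have hmissed : μ.real (D \ (A ∩ B)) ≤ μ.real ((A ∪ B) \ (A ∩ B)) :=
    measureReal_mono (Set.sdiff_subset_sdiff_left hD)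
      (measure_ne_top_of_subset Set.sdiff_subset hU)
  rw [hUinter] at hUsplit
  rw [hunion] at hPQadd
  linarith

variable {n m : ℕ} {J : Fin n → Set α}

lemma measurableSet_coveredBy (hJ : ∀ i, MeasurableSet (J i)) (g : Fin n → Fin m) (k : ℕ)
    (a : Fin m) : MeasurableSet (coveredBy J g k a) := by
  rw [coveredBy_eq_iUnion]
  exact .iUnion fun j => .iUnion fun _ => hJ j

lemma measure_iUnion_fin_ne_top (hJ : ∀ i, μ (J i) ≠ ⊤) : μ (⋃ i, J i) ≠ ⊤ :=
  ((measure_iUnion_fintype_le μ J).trans_lt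
    (ENNReal.sum_lt_top.2 fun i _ => (hJ i).lt_top)).ne

lemma measure_coveredBy_ne_top (hJ : ∀ i, μ (J i) ≠ ⊤) (g : Fin n → Fin m) (k : ℕ)
    (a : Fin m) : μ (coveredBy J g k a) ≠ ⊤ :=
  measure_ne_top_of_subset (fun _ ⟨j, _, _, hx⟩ => Set.mem_iUnion.2 ⟨j, hx⟩)
    (measure_iUnion_fin_ne_top hJ)

/-- If each set is placed where its marginal gain is largest, then the multiply covered points
which are not covered on both machines have measure at most that of those which are. -/
lemma measureReal_multiplyCovered_diff_le (hJ : ∀ i, MeasurableSet (J i))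
    (hJf : ∀ i, μ (J i) ≠ ⊤) (g : Fin n → Fin 2)
    (hg : ∀ i b, μ.real (J i \ coveredBy J g i b) ≤ μ.real (J i \ coveredBy J g i (g i)))
    (k : ℕ) (hk : k ≤ n) :
    μ.real (multiplyCovered J k \ (coveredBy J g k 0 ∩ coveredBy J g k 1)) ≤
      μ.real (coveredBy J g k 0 ∩ coveredBy J g k 1) := by
  induction k with
  | zero => simp [multiplyCovered]
  | succ k ih =>
    specialize ih (by omega)
    obtain ⟨i, rfl⟩ : ∃ i : Fin n, (i : ℕ) = k := ⟨⟨k, hk⟩, rfl⟩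
    have hM := measurableSet_coveredBy hJ g i
    have hF := measure_coveredBy_ne_top hJf g i
    have hDf : μ (multiplyCovered J i) ≠ ⊤ :=
      measure_ne_top_of_subset (multiplyCovered_subset_iUnion J _) (measure_iUnion_fin_ne_top hJf)
    have hD := multiplyCovered_succ_subset J g i
    have hself := coveredBy_succ_self J g i
    rcases Fin.exists_fin_two.1 ⟨g i, rfl⟩ with h | h
    · have hgain := hg i 1
      rw [h] at hself hgain
      rw [hself, coveredBy_succ_of_ne J g i (a := 1) (by simp [h])]
      exact measureReal_missed_le_of_gain_le (hM 0) (hM 1) (hJ i) (hF 0) (hF 1) (hJf i) hDf hD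
        hgain ih
    · have hgain := hg i 0
      rw [h] at hself hgain
      rw [hself, coveredBy_succ_of_ne J g i (a := 0) (by simp [h]), Set.inter_comm]
      rw [Set.union_comm (coveredBy J g i 0)] at hD
      rw [Set.inter_comm] at ih
      exact measureReal_missed_le_of_gain_le (hM 1) (hM 0) (hJ i) (hF 1) (hF 0) (hJf i) hDf hD
        hgain ih

end Measure

/-- Greedy is `4/3`-competitive on two machines. -/
theorem greedy_four_thirds_competitive (n : ℕ) (hn : 0 < n)
    (jobs : Fin n → ℝ × ℝ) (hjobs : ∀ i, (jobs i).1 < (jobs i).2)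
    (g : Fin n → Fin 2) (hg : IsGreedy jobs g) :
    opt 2 jobs ≤ (4 / 3) * profit jobs g := by
  set J : Fin n → Set ℝ := fun i => Set.Icc (jobs i).1 (jobs i).2 with hJdef
  have hJ (i : Fin n) : MeasurableSet (J i) := measurableSet_Icc
  have hJf (i : Fin n) : volume (J i) ≠ ⊤ := measure_Icc_lt_top.ne
  have hprofit (f : Fin n → Fin 2) : profit jobs f =
      volume.real (coveredBy J f n 0) + volume.real (coveredBy J f n 1) := by
    simp only [profit, Fin.sum_univ_two, coveredBy_length, measureReal_def, hJdef]
  have hgain (i : Fin n) (b : Fin 2) :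
      gain jobs g i b = volume.real (J i \ coveredBy J g i b) := by
    simp only [gain, coveredBy_eq_iUnion, measureReal_def, hJdef, Fin.lt_def]
  have hM := measurableSet_coveredBy (m := 2) hJ
  have hF := measure_coveredBy_ne_top (m := 2) hJf
  refine ciSup_le fun f => ?_
  rw [hprofit, hprofit]
  refine measureReal_add_le_four_thirds_mul (hM g n 1) (hM f n 1) (hF g n 0) (hF g n 1)
    (hF f n 0) (hF f n 1) (hM g n 0) ?_
    (coveredBy_inter_subset_multiplyCovered J f zero_ne_one) ?_
    (measureReal_multiplyCovered_diff_le hJ hJf g (fun i b => ?_) n le_rfl)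
  · rw [coveredBy_union_eq_iUnion, coveredBy_union_eq_iUnion]
  · rw [coveredBy_union_eq_iUnion]
    exact multiplyCovered_subset_iUnion J n
  · rw [← hgain, ← hgain]
    exact (hg i).1 b
end

section
/- (Theorem: lower bound for greedy on two machines.) For m = 2 machines and for every ε > 0, there exists an instance σ of the uniform profit case with V_GR(σ) > 0 and OPT(σ) ≥ (4/3 − ε) · V_GR(σ). -/
open MeasureTheory

/-- Three jobs on which greedy, with the placement `![0, 1, 0]`, earns `3 + δ` out of `4`. -/
noncomputable def threeJobs (δ : ℝ) : Fin 3 → ℝ × ℝ :=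
  ![(0, 1), (1 - δ, 2), (0, 2)]

theorem biUnion_threeJobs (δ : ℝ) (p : Fin 3 → Prop) :
    (⋃ i : Fin 3, ⋃ (_ : p i), Set.Icc (threeJobs δ i).1 (threeJobs δ i).2) =
      {x | (p 0 ∧ x ∈ Set.Icc 0 1) ∨ (p 1 ∧ x ∈ Set.Icc (1 - δ) 2) ∨
        (p 2 ∧ x ∈ Set.Icc 0 2)} := by
  ext x
  simp [threeJobs, Fin.exists_fin_succ, -tsub_le_iff_right]
  grind

theorem isGreedy_threeJobs {δ : ℝ} (h0 : 0 < δ) (h1 : δ < 1) :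
    IsGreedy (threeJobs δ) (![0, 1, 0] : Fin 3 → Fin 2) := by
  have g0 (a : Fin 2) : gain (threeJobs δ) ![0, 1, 0] 0 a = 1 := by
    rw [gain, biUnion_threeJobs]
    simp [threeJobs]
  have g10 : gain (threeJobs δ) (![0, 1, 0] : Fin 3 → Fin 2) 1 0 = 1 := by
    rw [gain, biUnion_threeJobs]
    trans (volume (Set.Ioc (1 : ℝ) 2)).toReal
    · congr 2; ext x; simp [threeJobs]; grind
    · norm_num
  have g11 : gain (threeJobs δ) (![0, 1, 0] : Fin 3 → Fin 2) 1 1 = 1 + δ := by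
    rw [gain, biUnion_threeJobs]
    trans (volume (Set.Icc (1 - δ) 2)).toReal
    · congr 2; ext x; simp [threeJobs]
    · rw [Real.volume_Icc, ENNReal.toReal_ofReal] <;> linarith
  have g20 : gain (threeJobs δ) (![0, 1, 0] : Fin 3 → Fin 2) 2 0 = 1 := by
    rw [gain, biUnion_threeJobs]
    trans (volume (Set.Ioc (1 : ℝ) 2)).toReal
    · congr 2; ext x; simp [threeJobs]; grind
    · norm_num
  have g21 : gain (threeJobs δ) (![0, 1, 0] : Fin 3 → Fin 2) 2 1 = 1 - δ := by
    rw [gain, biUnion_threeJobs]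
    trans (volume (Set.Ico 0 (1 - δ))).toReal
    · congr 2; ext x; simp [threeJobs]; grind
    · rw [Real.volume_Ico, ENNReal.toReal_ofReal] <;> linarith
  intro i
  fin_cases i <;> simp [Fin.forall_fin_two, g0, g10, g11, g20, g21] <;> grind

theorem profit_threeJobs_greedy {δ : ℝ} (h0 : 0 < δ) (h1 : δ < 1) :
    profit (threeJobs δ) (![0, 1, 0] : Fin 3 → Fin 2) = 3 + δ := by
  simp only [profit, Fin.sum_univ_two, biUnion_threeJobs]
  have e0 : {x : ℝ | (0 ≤ x ∧ x ≤ 1) ∨ (0 ≤ x ∧ x ≤ 2)} = Set.Icc 0 2 := by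
    ext x; simp; grind
  have e1 : {x : ℝ | 1 - δ ≤ x ∧ x ≤ 2} = Set.Icc (1 - δ) 2 := rfl
  simp [e0, e1, -tsub_le_iff_right]
  rw [ENNReal.toReal_ofReal] <;> linarith

theorem profit_threeJobs_optimal {δ : ℝ} (h0 : 0 < δ) (h1 : δ < 1) :
    profit (threeJobs δ) (![0, 0, 1] : Fin 3 → Fin 2) = 4 := by
  simp only [profit, Fin.sum_univ_two, biUnion_threeJobs]
  have e0 : {x : ℝ | (0 ≤ x ∧ x ≤ 1) ∨ (1 - δ ≤ x ∧ x ≤ 2)} = Set.Icc 0 2 := by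
    ext x; simp; grind
  have e1 : {x : ℝ | 0 ≤ x ∧ x ≤ 2} = Set.Icc 0 2 := rfl
  simp [e0, e1, -tsub_le_iff_right]
  norm_num

/-- Lower bound for greedy on two machines: for every `ε > 0` there is an
instance with `V_GR(σ) > 0` and `OPT(σ) ≥ (4/3 − ε) · V_GR(σ)`. -/
theorem greedy_lower_bound_two_machines (ε : ℝ) (hε : 0 < ε) :
    ∃ (n : ℕ), 0 < n ∧ ∃ jobs : Fin n → ℝ × ℝ,
      (∀ i, (jobs i).1 < (jobs i).2) ∧
      ∃ g : Fin n → Fin 2, IsGreedy jobs g ∧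
        0 < profit jobs g ∧
        (4 / 3 - ε) * profit jobs g ≤ opt 2 jobs := by
  obtain ⟨δ, h0, h1, hδ⟩ : ∃ δ : ℝ, 0 < δ ∧ δ < 1 ∧ δ ≤ ε :=
    ⟨min ε (1 / 2), by positivity, by norm_num, min_le_left _ _⟩
  refine ⟨3, by norm_num, threeJobs δ, ?_, ![0, 1, 0], isGreedy_threeJobs h0 h1, ?_, ?_⟩
  · intro i
    fin_cases i <;> simp [threeJobs]
    linarith
  · rw [profit_threeJobs_greedy h0 h1]
    positivity
  · calc (4 / 3 - ε) * profit (threeJobs δ) ![0, 1, 0] ≤ 4 := by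
          rw [profit_threeJobs_greedy h0 h1]
          nlinarith
      _ = profit (threeJobs δ) (![0, 0, 1] : Fin 3 → Fin 2) :=
          (profit_threeJobs_optimal h0 h1).symm
      _ ≤ opt 2 (threeJobs δ) := le_ciSup (Set.finite_range _).bddAbove _
end

section
/- (Tightness of the 4/3 analysis.) For m = 2 machines, the supremum over all instances σ of the uniform profit case (with V_GR(σ) > 0) of the ratio OPT(σ)/V_GR(σ) equals 4/3. -/
open MeasureTheory

section Coverage

variable {α : Type*} {n m : ℕ}

/-- The points covered on machine `a` by the jobs of index smaller than `k`. -/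
def covered (S : Fin n → Set α) (g : Fin n → Fin m) (k : ℕ) (a : Fin m) : Set α :=
  ⋃ j : Fin n, ⋃ (_ : j.val < k ∧ g j = a), S j

/-- The points lying in at least two of the jobs of index smaller than `k`. -/
def doubled (S : Fin n → Set α) (k : ℕ) : Set α :=
  {x | ∃ i j : Fin n, i < j ∧ j.val < k ∧ x ∈ S i ∧ x ∈ S j}

theorem covered_succ_self (S : Fin n → Set α) (g : Fin n → Fin m) (i : Fin n) :
    covered S g (i + 1) (g i) = covered S g i (g i) ∪ S i := by
  ext x
  simp only [covered, Set.mem_iUnion, Set.mem_union, exists_prop]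
  constructor
  · rintro ⟨j, ⟨hj, hg⟩, hx⟩
    rcases Nat.lt_succ_iff_lt_or_eq.1 hj with h | h
    · exact Or.inl ⟨j, ⟨h, hg⟩, hx⟩
    · exact Or.inr (Fin.ext h ▸ hx)
  · rintro (⟨j, ⟨hj, hg⟩, hx⟩ | hx)
    · exact ⟨j, ⟨by omega, hg⟩, hx⟩
    · exact ⟨i, ⟨by omega, rfl⟩, hx⟩

theorem covered_succ_of_ne (S : Fin n → Set α) {g : Fin n → Fin m} {i : Fin n} {a : Fin m}
    (h : g i ≠ a) : covered S g (i + 1) a = covered S g i a := by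
  ext x
  simp only [covered, Set.mem_iUnion, exists_prop]
  constructor
  · rintro ⟨j, ⟨hj, hg⟩, hx⟩
    refine ⟨j, ⟨lt_of_le_of_ne (by omega) fun h' => h ?_, hg⟩, hx⟩
    rw [← Fin.ext h', hg]
  · rintro ⟨j, ⟨hj, hg⟩, hx⟩
    exact ⟨j, ⟨by omega, hg⟩, hx⟩

theorem doubled_succ_subset (S : Fin n → Set α) (g : Fin n → Fin 2) (i : Fin n) :
    doubled S (i + 1) ⊆ doubled S i ∪ S i ∩ (covered S g i 0 ∪ covered S g i 1) := by
  rintro x ⟨j, l, hjl, hl, hxj, hxl⟩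
  rcases Nat.lt_succ_iff_lt_or_eq.1 hl with h | h
  · exact Or.inl ⟨j, l, hjl, h, hxj, hxl⟩
  · obtain rfl := Fin.ext h
    refine Or.inr ⟨hxl, ?_⟩
    simp only [covered, Set.mem_union, Set.mem_iUnion, exists_prop]
    have hj : g j = 0 ∨ g j = 1 := by omega
    exact hj.imp (fun h => ⟨j, ⟨hjl, h⟩, hxj⟩) fun h => ⟨j, ⟨hjl, h⟩, hxj⟩

variable [MeasurableSpace α]

theorem measurableSet_covered {S : Fin n → Set α} (hS : ∀ i, MeasurableSet (S i))
    (g : Fin n → Fin m) (k : ℕ) (a : Fin m) : MeasurableSet (covered S g k a) :=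
  MeasurableSet.iUnion fun i => MeasurableSet.iUnion fun _ => hS i

theorem measure_covered_ne_top {μ : Measure α} {S : Fin n → Set α} (hS : ∀ i, μ (S i) ≠ ⊤)
    (g : Fin n → Fin m) (k : ℕ) (a : Fin m) : μ (covered S g k a) ≠ ⊤ := by
  have h : μ (⋃ i, S i) < ⊤ :=
    (measure_iUnion_fintype_le μ S).trans_lt (ENNReal.sum_lt_top.2 fun i _ => (hS i).lt_top)
  refine ((measure_mono ?_).trans_lt h).ne
  exact Set.iUnion_mono fun i => Set.iUnion_subset fun _ => subset_rfl

/-- One greedy step: adding `I` to the machine covering `A` instead of the one covering `B`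
creates at least as much new double coverage as it wastes. -/
theorem measureReal_diff_inter_le_of_greedy_step {μ : Measure α} {A B I D D' : Set α}
    (hA : MeasurableSet A) (hB : MeasurableSet B) (hI : MeasurableSet I)
    (hA' : μ A ≠ ⊤) (hB' : μ B ≠ ⊤) (hI' : μ I ≠ ⊤) (hD : μ D ≠ ⊤)
    (hgreedy : μ.real (I \ B) ≤ μ.real (I \ A))
    (hwaste : μ.real (D \ (A ∩ B)) ≤ μ.real (A ∩ B))
    (hD' : D' ⊆ D ∪ I ∩ (A ∪ B)) :
    μ.real (D' \ ((A ∪ I) ∩ B)) ≤ μ.real ((A ∪ I) ∩ B) := by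
  have hdA := measureReal_sdiff_add_inter (μ := μ) (s := I \ A) hB
    (measure_ne_top_of_subset Set.sdiff_subset hI')
  have hdB := measureReal_sdiff_add_inter (μ := μ) (s := I \ B) hA
    (measure_ne_top_of_subset Set.sdiff_subset hI')
  have hcomm : (I \ A) \ B = (I \ B) \ A := by
    ext; simp only [Set.mem_sdiff]; tauto
  rw [hcomm] at hdA
  have hnew : μ.real (A ∩ B) + μ.real ((I \ A) ∩ B) = μ.real ((A ∪ I) ∩ B) := by
    rw [← measureReal_union _ ((hI.diff hA).inter hB)
      (measure_ne_top_of_subset Set.inter_subset_left hA')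
      (measure_ne_top_of_subset Set.inter_subset_right hB')]
    · congr 1
      ext; simp only [Set.mem_union, Set.mem_inter_iff, Set.mem_sdiff]; tauto
    · rw [Set.disjoint_left]
      exact fun x hx hx' => hx'.1.2 hx.1
  have hle : μ.real (D' \ ((A ∪ I) ∩ B)) ≤ μ.real (D \ (A ∩ B)) + μ.real ((I \ B) ∩ A) := by
    refine (measureReal_mono ?_ ?_).trans (measureReal_union_le _ _)
    · rintro x ⟨hx, hx'⟩
      have := hD' hx
      simp only [Set.mem_union, Set.mem_inter_iff, Set.mem_sdiff] at *
      tauto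
    · exact (measure_union_lt_top (measure_ne_top_of_subset Set.sdiff_subset hD).lt_top
        (measure_ne_top_of_subset Set.inter_subset_right hA').lt_top).ne
  linarith

theorem measureReal_doubled_diff_le_of_greedy {μ : Measure α} {S : Fin n → Set α}
    (hS : ∀ i, MeasurableSet (S i)) (hS' : ∀ i, μ (S i) ≠ ⊤) {g : Fin n → Fin 2}
    (hg : ∀ i b, μ.real (S i \ covered S g i b) ≤ μ.real (S i \ covered S g i (g i)))
    (k : ℕ) (hk : k ≤ n) :
    μ.real (doubled S k \ (covered S g k 0 ∩ covered S g k 1)) ≤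
      μ.real (covered S g k 0 ∩ covered S g k 1) := by
  induction k with
  | zero => simp [doubled]
  | succ k ih =>
    have ih := ih (by omega)
    have hD : μ (doubled S k) ≠ ⊤ := by
      have hfin : μ (⋃ i, S i) ≠ ⊤ := ((measure_iUnion_fintype_le μ S).trans_lt
        (ENNReal.sum_lt_top.2 fun i _ => (hS' i).lt_top)).ne
      refine measure_ne_top_of_subset ?_ hfin
      rintro x ⟨i, -, -, -, hx, -⟩
      exact Set.mem_iUnion.2 ⟨i, hx⟩
    obtain ⟨i, rfl⟩ : ∃ i : Fin n, i.val = k := ⟨⟨k, hk⟩, rfl⟩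
    have hsub := doubled_succ_subset S g i
    have hm := measurableSet_covered hS g i
    have ht := measure_covered_ne_top hS' g i
    have hgi : g i = 0 ∨ g i = 1 := by omega
    have hself := covered_succ_self S g i
    rcases hgi with h | h
    · have hother := covered_succ_of_ne S (g := g) (i := i) (a := 1) (by simp [h])
      have hgain := hg i 1
      rw [h] at hself hgain
      rw [hself, hother]
      exact measureReal_diff_inter_le_of_greedy_step (hm 0) (hm 1) (hS i) (ht 0) (ht 1) (hS' i)
        hD hgain ih hsub
    · have hother := covered_succ_of_ne S (g := g) (i := i) (a := 0) (by simp [h])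
      have hgain := hg i 0
      rw [h] at hself hgain
      rw [hself, hother, Set.inter_comm]
      rw [Set.inter_comm] at ih
      rw [Set.union_comm (covered S g i 0)] at hsub
      exact measureReal_diff_inter_le_of_greedy_step (hm 1) (hm 0) (hS i) (ht 1) (ht 0) (hS' i)
        hD hgain ih hsub

theorem three_mul_coverage_le_four_mul_greedy {μ : Measure α} {S : Fin n → Set α}
    (hS : ∀ i, MeasurableSet (S i)) (hS' : ∀ i, μ (S i) ≠ ⊤) {g : Fin n → Fin 2}
    (hg : ∀ i b, μ.real (S i \ covered S g i b) ≤ μ.real (S i \ covered S g i (g i)))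
    (f : Fin n → Fin 2) :
    3 * (μ.real (covered S f n 0) + μ.real (covered S f n 1)) ≤
      4 * (μ.real (covered S g n 0) + μ.real (covered S g n 1)) := by
  have hwaste := measureReal_doubled_diff_le_of_greedy hS hS' hg n le_rfl
  have hmg := measurableSet_covered hS g n
  have htg := measure_covered_ne_top hS' g n
  have htf := measure_covered_ne_top hS' f n
  have htgU := (measure_union_lt_top (htg 0).lt_top (htg 1).lt_top).ne
  have hf := measureReal_union_add_inter (μ := μ) (s := covered S f n 0)
    (measurableSet_covered hS f n 1) (htf 0) (htf 1)
  have hgu := measureReal_union_add_inter (μ := μ) (s := covered S g n 0) (hmg 1) (htg 0) (htg 1)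
  have hsub : ∀ i x, x ∈ S i → x ∈ covered S g n 0 ∪ covered S g n 1 := by
    intro i x hx
    simp only [covered, Set.mem_union, Set.mem_iUnion, exists_prop]
    have hi : g i = 0 ∨ g i = 1 := by omega
    exact hi.imp (fun h => ⟨i, ⟨i.2, h⟩, hx⟩) fun h => ⟨i, ⟨i.2, h⟩, hx⟩
  have hdsub : doubled S n ⊆ covered S g n 0 ∪ covered S g n 1 := by
    rintro x ⟨i, -, -, -, hx, -⟩
    exact hsub i x hx
  have htD := measure_ne_top_of_subset hdsub htgU
  have hU : μ.real (covered S f n 0 ∪ covered S f n 1) ≤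
      μ.real (covered S g n 0 ∪ covered S g n 1) := by
    refine measureReal_mono ?_ htgU
    refine Set.union_subset ?_ ?_ <;>
      exact Set.iUnion_subset fun i => Set.iUnion_subset fun _ => hsub i
  have hI : μ.real (covered S f n 0 ∩ covered S f n 1) ≤ μ.real (doubled S n) := by
    refine measureReal_mono ?_ htD
    rintro x ⟨hx, hx'⟩
    simp only [covered, Set.mem_iUnion, exists_prop] at hx hx'
    obtain ⟨i, ⟨-, hi⟩, hxi⟩ := hx
    obtain ⟨j, ⟨-, hj⟩, hxj⟩ := hx'
    have hij : i ≠ j := by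
      rintro rfl
      simp [hi] at hj
    rcases hij.lt_or_gt with h | h
    · exact ⟨i, j, h, j.2, hxi, hxj⟩
    · exact ⟨j, i, h, i.2, hxj, hxi⟩
  have hD := measureReal_sdiff_add_inter (μ := μ) (s := doubled S n) ((hmg 0).inter (hmg 1)) htD
  have hDI : μ.real (doubled S n ∩ (covered S g n 0 ∩ covered S g n 1)) ≤
      μ.real (covered S g n 0 ∩ covered S g n 1) :=
    measureReal_mono Set.inter_subset_right
      (measure_ne_top_of_subset Set.inter_subset_left (htg 0))
  have hsum : μ.real (doubled S n \ (covered S g n 0 ∩ covered S g n 1)) +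
      μ.real (covered S g n 0 ∩ covered S g n 1) ≤
      μ.real (covered S g n 0 ∪ covered S g n 1) := by
    rw [← measureReal_union Set.disjoint_sdiff_left ((hmg 0).inter (hmg 1))
      (measure_ne_top_of_subset Set.sdiff_subset htD)
      (measure_ne_top_of_subset Set.inter_subset_left (htg 0))]
    refine measureReal_mono (Set.union_subset (Set.sdiff_subset.trans hdsub) ?_) htgU
    exact Set.inter_subset_left.trans Set.subset_union_left
  linarith

end Coverage

theorem profit_two_eq {n : ℕ} (jobs : Fin n → ℝ × ℝ) (f : Fin n → Fin 2) :
    profit jobs f = volume.real (covered (fun i => Set.Icc (jobs i).1 (jobs i).2) f n 0) +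
      volume.real (covered (fun i => Set.Icc (jobs i).1 (jobs i).2) f n 1) := by
  simp [profit, covered, Measure.real]

theorem IsGreedy.three_mul_opt_le {n : ℕ} {jobs : Fin n → ℝ × ℝ} {g : Fin n → Fin 2}
    (hg : IsGreedy jobs g) : 3 * opt 2 jobs ≤ 4 * profit jobs g := by
  have h : opt 2 jobs ≤ 4 / 3 * profit jobs g := by
    refine ciSup_le fun f => ?_
    have := three_mul_coverage_le_four_mul_greedy (μ := volume)
      (S := fun i => Set.Icc (jobs i).1 (jobs i).2) (fun _ => measurableSet_Icc)
      (fun _ => by simp) (g := g) (fun i b => (hg i).1 b) f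
    rw [profit_two_eq, profit_two_eq]
    linarith
  linarith

/-- The instance `[0, 1], [1 - ε, 2], [0, 2]`, on which greedy reaches only `3 + ε` out of `4`. -/
def tightJobs (ε : ℝ) : Fin 3 → ℝ × ℝ := ![(0, 1), (1 - ε, 2), (0, 2)]

theorem iUnion_fin_three {α : Type*} (s : Fin 3 → Set α) : ⋃ i, s i = s 0 ∪ s 1 ∪ s 2 := by
  ext x
  simp [Fin.exists_fin_succ, or_assoc]

theorem isGreedy_tightJobs {ε : ℝ} (h0 : 0 < ε) (h1 : ε < 1) :
    IsGreedy (tightJobs ε) (![0, 1, 0] : Fin 3 → Fin 2) := by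
  have e1 : Set.Icc (1 - ε) 2 \ Set.Icc 0 1 = Set.Ioc 1 2 := by
    ext x; simp only [Set.mem_sdiff, Set.mem_Icc, Set.mem_Ioc, not_and, not_le]
    exact ⟨fun h => ⟨h.2 (by linarith), h.1.2⟩, fun h => ⟨⟨by linarith, h.2⟩, fun _ => h.1⟩⟩
  have e2 : Set.Icc (0 : ℝ) 2 \ Set.Icc 0 1 = Set.Ioc 1 2 := by
    ext x; simp only [Set.mem_sdiff, Set.mem_Icc, Set.mem_Ioc, not_and, not_le]
    exact ⟨fun h => ⟨h.2 h.1.1, h.1.2⟩, fun h => ⟨⟨by linarith, h.2⟩, fun _ => h.1⟩⟩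
  have e3 : Set.Icc (0 : ℝ) 2 \ Set.Icc (1 - ε) 2 = Set.Ico 0 (1 - ε) := by
    ext x; simp only [Set.mem_sdiff, Set.mem_Icc, Set.mem_Ico, not_and, not_le]
    refine ⟨fun h => ⟨h.1.1, ?_⟩, fun h => ⟨⟨h.1, by linarith⟩, fun _ => by linarith⟩⟩
    by_contra! h'
    linarith [h.2 h', h.1.2]
  have g00 : gain (tightJobs ε) (![0, 1, 0] : Fin 3 → Fin 2) 0 0 = 1 := by
    simp [gain, tightJobs]
  have g01 : gain (tightJobs ε) (![0, 1, 0] : Fin 3 → Fin 2) 0 1 = 1 := by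
    simp [gain, tightJobs]
  have g10 : gain (tightJobs ε) (![0, 1, 0] : Fin 3 → Fin 2) 1 0 = 1 := by
    simp [gain, tightJobs, iUnion_fin_three, e1]
    norm_num
  have g11 : gain (tightJobs ε) (![0, 1, 0] : Fin 3 → Fin 2) 1 1 = 1 + ε := by
    simp [gain, tightJobs, iUnion_fin_three]
    rw [ENNReal.toReal_ofReal] <;> linarith
  have g20 : gain (tightJobs ε) (![0, 1, 0] : Fin 3 → Fin 2) 2 0 = 1 := by
    simp [gain, tightJobs, iUnion_fin_three, e2]
    norm_num
  have g21 : gain (tightJobs ε) (![0, 1, 0] : Fin 3 → Fin 2) 2 1 = 1 - ε := by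
    simp [gain, tightJobs, iUnion_fin_three, e3]
    linarith
  intro i
  fin_cases i
  · simp [Fin.forall_fin_two, g00, g01]
  · simp [Fin.forall_fin_two, g10, g11, h0.le, h0.ne']
  · simp [Fin.forall_fin_two, g20, g21, h0.le]

theorem profit_tightJobs_greedy {ε : ℝ} (h0 : 0 < ε) :
    profit (tightJobs ε) (![0, 1, 0] : Fin 3 → Fin 2) = 3 + ε := by
  have e : Set.Icc (0 : ℝ) 1 ∪ Set.Icc 0 2 = Set.Icc 0 2 :=
    Set.union_eq_self_of_subset_left (Set.Icc_subset_Icc_right (by norm_num))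
  simp [profit, tightJobs, iUnion_fin_three, e]
  rw [ENNReal.toReal_ofReal] <;> linarith

theorem four_le_opt_tightJobs {ε : ℝ} (h0 : 0 < ε) (h1 : ε < 1) : 4 ≤ opt 2 (tightJobs ε) := by
  have e : Set.Icc (0 : ℝ) 1 ∪ Set.Icc (1 - ε) 2 = Set.Icc 0 2 := by
    rw [Set.Icc_union_Icc' (by linarith) (by linarith), min_eq_left (by linarith),
      max_eq_right (by norm_num)]
  have hp : profit (tightJobs ε) (![0, 0, 1] : Fin 3 → Fin 2) = 4 := by
    simp [profit, tightJobs, iUnion_fin_three, e]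
    norm_num
  rw [← hp]
  exact le_ciSup (f := fun f : Fin 3 → Fin 2 => profit (tightJobs ε) f)
    (Set.finite_range _).bddAbove _

/-- Tightness of the `4/3` analysis: for two machines, the supremum over all
instances (with positive greedy profit) of `OPT(σ) / V_GR(σ)` equals `4/3`. -/
theorem greedy_ratio_sup_eq_four_thirds :
    IsLUB { x : ℝ | ∃ (n : ℕ), 0 < n ∧ ∃ jobs : Fin n → ℝ × ℝ,
        (∀ i, (jobs i).1 < (jobs i).2) ∧
        ∃ g : Fin n → Fin 2, IsGreedy jobs g ∧ 0 < profit jobs g ∧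
          x = opt 2 jobs / profit jobs g } (4 / 3) := by
  
  constructor
  · rintro x ⟨n, -, jobs, -, g, hg, hpos, rfl⟩
    rw [div_le_iff₀ hpos]
    linarith [hg.three_mul_opt_le]
  · intro b hb
    have hε : ∀ ε : ℝ, 0 < ε → ε < 1 → 4 ≤ b * (3 + ε) := by
      intro ε h0 h1
      have hp := profit_tightJobs_greedy h0
      have hle : opt 2 (tightJobs ε) / (3 + ε) ≤ b := by
        refine hb ⟨3, by norm_num, tightJobs ε, ?_, ![0, 1, 0], isGreedy_tightJobs h0 h1, ?_, ?_⟩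
        · intro i
          fin_cases i <;> simp [tightJobs]
          linarith
        · rw [hp]; linarith
        · rw [hp]
      rw [div_le_iff₀ (by linarith)] at hle
      exact (four_le_opt_tightJobs h0 h1).trans hle
    have hlim : Filter.Tendsto (fun ε : ℝ => b * (3 + ε)) (nhdsWithin 0 (Set.Ioi 0))
        (nhds (b * (3 + 0))) :=
      (Continuous.tendsto (by fun_prop) 0).mono_left nhdsWithin_le_nhds
    have := ge_of_tendsto hlim (Filter.eventually_of_mem (Ioo_mem_nhdsGT one_pos)
      fun ε h => hε ε h.1 h.2)
    linarith
end

section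
/- (Explicit hard instance for greedy, m = 2.) Let 0 < ε < 1 and consider the instance on m = 2 machines consisting of the four jobs, in this order: J_1 = [0, 1], J_2 = [2 − ε, 2], J_3 = [1, 2], J_4 = [0, 2]. Then the greedy placement has profit V_GR(σ) = 3 + ε, while OPT(σ) = 4; hence OPT(σ)/V_GR(σ) = 4/(3 + ε). -/
open MeasureTheory

theorem profit_le_of_subset_Icc {n m : ℕ} {jobs : Fin n → ℝ × ℝ} {r d : ℝ} (hrd : r ≤ d)
    (h : ∀ i, Set.Icc (jobs i).1 (jobs i).2 ⊆ Set.Icc r d) (f : Fin n → Fin m) :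
    profit jobs f ≤ m * (d - r) := by
  have key : ∀ a ∈ (Finset.univ : Finset (Fin m)),
      (volume (⋃ i : Fin n, ⋃ (_ : f i = a), Set.Icc (jobs i).1 (jobs i).2)).toReal ≤ d - r := by
    intro a _
    have hsub : (⋃ i : Fin n, ⋃ (_ : f i = a), Set.Icc (jobs i).1 (jobs i).2) ⊆ Set.Icc r d :=
      Set.iUnion₂_subset fun i _ => h i
    have hvol := ENNReal.toReal_mono (by simp) (measure_mono (μ := volume) hsub)
    rwa [Real.volume_Icc, ENNReal.toReal_ofReal (by linarith)] at hvol
  simpa [profit, mul_sub] using Finset.sum_le_sum key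

/-- Explicit hard instance for greedy on two machines: the instance
`J₁ = [0,1]`, `J₂ = [2−ε,2]`, `J₃ = [1,2]`, `J₄ = [0,2]` has greedy profit
`3 + ε`, optimal profit `4`, hence ratio `4 / (3 + ε)`. -/
theorem greedy_hard_instance (ε : ℝ) (hε0 : 0 < ε) (hε1 : ε < 1)
    (jobs : Fin 4 → ℝ × ℝ)
    (hjobs : jobs = ![(0, 1), (2 - ε, 2), (1, 2), (0, 2)])
    (g : Fin 4 → Fin 2) (hg : IsGreedy jobs g) :
    profit jobs g = 3 + ε ∧ opt 2 jobs = 4 ∧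
      opt 2 jobs / profit jobs g = 4 / (3 + ε) := by
  have h0 : jobs 0 = (0, 1) := by simp [hjobs]
  have h1 : jobs 1 = (2 - ε, 2) := by simp [hjobs]
  have h2 : jobs 2 = (1, 2) := by simp [hjobs]
  have h3 : jobs 3 = (0, 2) := by simp [hjobs]
  have fin_two : ∀ a : Fin 2, a = 0 ∨ a = 1 := by decide
  have g0 : g 0 = 0 := by
    have h := (hg 0).2 0 (by simp [gain])
    simpa using h
  have g1 : g 1 = 0 := by
    have hgain : ∀ b, gain jobs g 1 b = ε := by
      intro b
      have hset : (Set.Icc (jobs 1).1 (jobs 1).2 \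
          ⋃ j : Fin 4, ⋃ (_ : j < 1 ∧ g j = b), Set.Icc (jobs j).1 (jobs j).2)
            = Set.Icc (2 - ε) 2 := by
        ext x
        simp [Fin.exists_fin_succ, h0, h1, g0]
        grind
      rw [gain, hset, Real.volume_Icc, ENNReal.toReal_ofReal] <;> linarith
    have h := (hg 1).2 0 (by rw [hgain, hgain])
    simpa using h
  have g2 : g 2 = 1 := by
    have hgain0 : gain jobs g 2 0 = 1 - ε := by
      have hset : (Set.Icc (jobs 2).1 (jobs 2).2 \
          ⋃ j : Fin 4, ⋃ (_ : j < 2 ∧ g j = 0), Set.Icc (jobs j).1 (jobs j).2)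
            = Set.Ioo 1 (2 - ε) := by
        ext x
        simp [Fin.exists_fin_succ, h0, h1, h2, g0, g1]
        grind
      rw [gain, hset, Real.volume_Ioo, ENNReal.toReal_ofReal] <;> linarith
    have hgain1 : gain jobs g 2 1 = 1 := by
      have hset : (Set.Icc (jobs 2).1 (jobs 2).2 \
          ⋃ j : Fin 4, ⋃ (_ : j < 2 ∧ g j = 1), Set.Icc (jobs j).1 (jobs j).2)
            = Set.Icc 1 2 := by
        ext x
        simp [Fin.exists_fin_succ, h2, g0, g1]
      rw [gain, hset, Real.volume_Icc, ENNReal.toReal_ofReal] <;> linarith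
    refine (fin_two (g 2)).resolve_left fun h => ?_
    have hle := (hg 2).1 1
    rw [h, hgain0, hgain1] at hle
    linarith
  have g3 : g 3 = 1 := by
    have hgain0 : gain jobs g 3 0 = 1 - ε := by
      have hset : (Set.Icc (jobs 3).1 (jobs 3).2 \
          ⋃ j : Fin 4, ⋃ (_ : j < 3 ∧ g j = 0), Set.Icc (jobs j).1 (jobs j).2)
            = Set.Ioo 1 (2 - ε) := by
        ext x
        simp [Fin.exists_fin_succ, h0, h1, h3, g0, g1, g2]
        grind
      rw [gain, hset, Real.volume_Ioo, ENNReal.toReal_ofReal] <;> linarith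
    have hgain1 : gain jobs g 3 1 = 1 := by
      have hset : (Set.Icc (jobs 3).1 (jobs 3).2 \
          ⋃ j : Fin 4, ⋃ (_ : j < 3 ∧ g j = 1), Set.Icc (jobs j).1 (jobs j).2)
            = Set.Ico 0 1 := by
        ext x
        simp [Fin.exists_fin_succ, h2, h3, g0, g1, g2]
        grind
      rw [gain, hset, Real.volume_Ico, ENNReal.toReal_ofReal] <;> linarith
    refine (fin_two (g 3)).resolve_left fun h => ?_
    have hle := (hg 3).1 1
    rw [h, hgain0, hgain1] at hle
    linarith
  have hprofit : profit jobs g = 3 + ε := by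
    have hset0 : (⋃ i : Fin 4, ⋃ (_ : g i = 0), Set.Icc (jobs i).1 (jobs i).2)
        = Set.Icc 0 1 ∪ Set.Icc (2 - ε) 2 := by
      ext x
      simp [Fin.exists_fin_succ, h0, h1, g0, g1, g2, g3]
    have hset1 : (⋃ i : Fin 4, ⋃ (_ : g i = 1), Set.Icc (jobs i).1 (jobs i).2)
        = Set.Icc 0 2 := by
      ext x
      simp [Fin.exists_fin_succ, h2, h3, g0, g1, g2, g3]
      grind
    have hdisj : Disjoint (Set.Icc (0 : ℝ) 1) (Set.Icc (2 - ε) 2) :=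
      Set.disjoint_left.2 fun x hx hx' => by linarith [hx.2, hx'.1]
    rw [profit, Fin.sum_univ_two, hset0, hset1, measure_union hdisj measurableSet_Icc,
      Real.volume_Icc, Real.volume_Icc, Real.volume_Icc,
      ENNReal.toReal_add ENNReal.ofReal_ne_top ENNReal.ofReal_ne_top,
      ENNReal.toReal_ofReal (by norm_num), ENNReal.toReal_ofReal (by linarith),
      ENNReal.toReal_ofReal (by norm_num)]
    ring
  have hle : ∀ f : Fin 4 → Fin 2, profit jobs f ≤ 4 := by
    intro f
    have hsub : ∀ i, Set.Icc (jobs i).1 (jobs i).2 ⊆ Set.Icc 0 2 := by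
      intro i
      apply Set.Icc_subset_Icc <;> fin_cases i <;> simp [hjobs] <;> linarith
    have h := profit_le_of_subset_Icc (by norm_num) hsub f
    norm_num at h
    exact h
  have hattained : profit jobs (![0, 0, 0, 1] : Fin 4 → Fin 2) = 4 := by
    have hset0 : (⋃ i : Fin 4, ⋃ (_ : (![0, 0, 0, 1] : Fin 4 → Fin 2) i = 0),
        Set.Icc (jobs i).1 (jobs i).2) = Set.Icc 0 2 := by
      ext x
      simp [Fin.exists_fin_succ, h0, h1, h2]
      grind
    have hset1 : (⋃ i : Fin 4, ⋃ (_ : (![0, 0, 0, 1] : Fin 4 → Fin 2) i = 1),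
        Set.Icc (jobs i).1 (jobs i).2) = Set.Icc 0 2 := by
      ext x
      simp [Fin.exists_fin_succ, h3]
    rw [profit, Fin.sum_univ_two, hset0, hset1, Real.volume_Icc,
      ENNReal.toReal_ofReal (by norm_num)]
    norm_num
  have hopt : opt 2 jobs = 4 :=
    le_antisymm (ciSup_le hle) (hattained ▸ le_ciSup (Set.finite_range _).bddAbove _)
  exact ⟨hprofit, hopt, by rw [hopt, hprofit]⟩
end

section
/- (Key greedy coverage lemma used in the competitive analysis.) Fix an instance of the uniform profit case on m ≥ 2 machines, let g be the greedy placement and let f be an arbitrary placement of the same instance. Then for every job i, every machine a ∈ {1,…,m}, and every k with i ≤ k ≤ n, λ( {t ∈ (r_i, d_i) : there exists j ≤ k with g(j) = a and t ∈ (r_j, d_j)} \ N(i) ) ≥ λ( OE(i) ), where OE(i) is the oe-set of job i and N(i) is the n-set of job i. -/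
open MeasureTheory

/-- `t` is a profit point of job `i` under placement `f`: `t` lies in the open
interval of `i` and no earlier job on the same machine covers `t`. -/
def ProfitPoint {n m : ℕ} (jobs : Fin n → ℝ × ℝ) (f : Fin n → Fin m)
    (i : Fin n) (t : ℝ) : Prop :=
  t ∈ Set.Ioo (jobs i).1 (jobs i).2 ∧
    ∀ j : Fin n, j < i → f j = f i → t ∉ Set.Ioo (jobs j).1 (jobs j).2

/-- The oe-set of job `i`: points that are OPT-profit points but not GR-profit
points of `i`. -/
def oeSet {n m : ℕ} (jobs : Fin n → ℝ × ℝ) (g f : Fin n → Fin m)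
    (i : Fin n) : Set ℝ :=
  { t | ProfitPoint jobs f i t ∧ ¬ ProfitPoint jobs g i t }

/-- The n-set of job `i`: points of its open interval that are neither
GR-profit nor OPT-profit points of `i`. -/
def nSet {n m : ℕ} (jobs : Fin n → ℝ × ℝ) (g f : Fin n → Fin m)
    (i : Fin n) : Set ℝ :=
  { t | t ∈ Set.Ioo (jobs i).1 (jobs i).2 ∧
      ¬ ProfitPoint jobs g i t ∧ ¬ ProfitPoint jobs f i t }

/-- The union of the open intervals of the jobs before `i` that `f` places on machine `a`. -/
def coveredBefore {n m : ℕ} (jobs : Fin n → ℝ × ℝ) (f : Fin n → Fin m)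
    (i : Fin n) (a : Fin m) : Set ℝ :=
  ⋃ j : Fin n, ⋃ (_ : j < i ∧ f j = a), Set.Ioo (jobs j).1 (jobs j).2

section coveredBefore

variable {n m : ℕ} (jobs : Fin n → ℝ × ℝ) (f g : Fin n → Fin m) (i : Fin n) (a : Fin m)

lemma mem_coveredBefore {t : ℝ} :
    t ∈ coveredBefore jobs f i a ↔
      ∃ j, (j < i ∧ f j = a) ∧ t ∈ Set.Ioo (jobs j).1 (jobs j).2 := by
  simp only [coveredBefore, Set.mem_iUnion, exists_prop]

lemma measurableSet_coveredBefore : MeasurableSet (coveredBefore jobs f i a) :=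
  MeasurableSet.iUnion fun _ => MeasurableSet.iUnion fun _ => measurableSet_Ioo

lemma profitPoint_iff {t : ℝ} :
    ProfitPoint jobs f i t ↔
      t ∈ Set.Ioo (jobs i).1 (jobs i).2 ∧ t ∉ coveredBefore jobs f i (f i) := by
  simp only [ProfitPoint, mem_coveredBefore, not_exists, not_and, and_imp]

lemma gain_eq_measureReal_sdiff :
    gain jobs g i a =
      volume.real (Set.Ioo (jobs i).1 (jobs i).2 \ coveredBefore jobs g i a) := by
  refine measureReal_congr (Ioo_ae_eq_Icc.symm.diff ?_)
  exact Filter.EventuallyEq.countable_iUnion fun j =>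
    Filter.EventuallyEq.countable_iUnion fun _ => Ioo_ae_eq_Icc.symm

lemma measureReal_inter_coveredBefore_add_gain :
    volume.real (Set.Ioo (jobs i).1 (jobs i).2 ∩ coveredBefore jobs g i a) + gain jobs g i a =
      volume.real (Set.Ioo (jobs i).1 (jobs i).2) := by
  rw [gain_eq_measureReal_sdiff]
  exact measureReal_inter_add_sdiff (measurableSet_coveredBefore jobs g i a)
    measure_Ioo_lt_top.ne

lemma oeSet_eq :
    oeSet jobs g f i =
      (Set.Ioo (jobs i).1 (jobs i).2 ∩ coveredBefore jobs g i (g i)) \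
        coveredBefore jobs f i (f i) := by
  ext t
  simp only [oeSet, Set.mem_ofPred_eq, profitPoint_iff, Set.mem_sdiff, Set.mem_inter_iff]
  tauto

lemma nSet_eq :
    nSet jobs g f i =
      (Set.Ioo (jobs i).1 (jobs i).2 ∩ coveredBefore jobs g i (g i)) ∩
        coveredBefore jobs f i (f i) := by
  ext t
  simp only [nSet, Set.mem_ofPred_eq, profitPoint_iff, Set.mem_inter_iff]
  tauto

lemma measureReal_nSet_add_oeSet :
    volume.real (nSet jobs g f i) + volume.real (oeSet jobs g f i) =
      volume.real (Set.Ioo (jobs i).1 (jobs i).2 ∩ coveredBefore jobs g i (g i)) := by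
  rw [nSet_eq, oeSet_eq]
  exact measureReal_inter_add_sdiff (measurableSet_coveredBefore jobs f i (f i))
    (measure_ne_top_of_subset Set.inter_subset_left measure_Ioo_lt_top.ne)

end coveredBefore

/-- Key greedy coverage lemma: for every job `i`, machine `a` and index
`k ≥ i`, the part of `(r_i, d_i)` covered on machine `a` by greedy using the
first `k` jobs, with the n-set of `i` removed, has measure at least that of
the oe-set of `i`. -/
theorem greedy_coverage (m : ℕ) (hm : 2 ≤ m) (n : ℕ) (hn : 0 < n)
    (jobs : Fin n → ℝ × ℝ) (hjobs : ∀ i, (jobs i).1 < (jobs i).2)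
    (g : Fin n → Fin m) (hg : IsGreedy jobs g) (f : Fin n → Fin m)
    (i : Fin n) (a : Fin m) (k : Fin n) (hik : i ≤ k) :
    (volume (oeSet jobs g f i)).toReal ≤
      (volume ({ t | t ∈ Set.Ioo (jobs i).1 (jobs i).2 ∧
          ∃ j : Fin n, j ≤ k ∧ g j = a ∧ t ∈ Set.Ioo (jobs j).1 (jobs j).2 } \
        nSet jobs g f i)).toReal := by
  set C := {t | t ∈ Set.Ioo (jobs i).1 (jobs i).2 ∧
    ∃ j : Fin n, j ≤ k ∧ g j = a ∧ t ∈ Set.Ioo (jobs j).1 (jobs j).2}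
  have finite_of_subset {s : Set ℝ} (hs : s ⊆ Set.Ioo (jobs i).1 (jobs i).2) :
      volume s ≠ ⊤ := measure_ne_top_of_subset hs measure_Ioo_lt_top.ne
  have C_subset : C ⊆ Set.Ioo (jobs i).1 (jobs i).2 := fun t ht => ht.1
  have n_subset : nSet jobs g f i ⊆ Set.Ioo (jobs i).1 (jobs i).2 := fun t ht => ht.1
  have covered_le : volume.real (Set.Ioo (jobs i).1 (jobs i).2 ∩ coveredBefore jobs g i a) ≤
      volume.real C := by
    refine measureReal_mono ?_ (finite_of_subset C_subset)
    rintro t ⟨hti, htc⟩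
    obtain ⟨j, ⟨hji, hja⟩, htj⟩ := (mem_coveredBefore jobs g i a).1 htc
    exact ⟨hti, j, hji.le.trans hik, hja, htj⟩
  have C_le : volume.real C ≤
      volume.real (C \ nSet jobs g f i) + volume.real (nSet jobs g f i) :=
    (measureReal_mono (Set.subset_union_left.trans Set.sdiff_union_self.ge)
      (finite_of_subset (Set.union_subset (Set.sdiff_subset.trans C_subset) n_subset))).trans
      (measureReal_union_le _ _)
  change volume.real _ ≤ volume.real _
  linarith [(hg i).1 a, measureReal_inter_coveredBefore_add_gain jobs g i a,
    measureReal_inter_coveredBefore_add_gain jobs g i (g i),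
    measureReal_nSet_add_oeSet jobs f g i]
end

section
/- (Theorem: no bounded competitive ratio with general profits, two machines.) For m = 2 machines in the general profit model, for every deterministic online algorithm A and every constant c > 0 there exists an instance σ with OPT(σ) > c · V_A(σ). In other words, no deterministic online algorithm has a bounded competitive ratio. -/
open MeasureTheory

/- A weighted job is a triple `(r, d, v)` of reals with `r < d` and `v > 0`
(release time, deadline, profit).  An instance on `m` machines is a nonempty
finite sequence `jobs : Fin n → ℝ × ℝ × ℝ`; a placement is `f : Fin n → Fin m`. -/

/-- The profit gained from job `i` under placement `f`: the profit of a job is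
distributed uniformly over its interval and at each time is shared equally
among the jobs present on the same machine (the count includes `i` itself). -/
noncomputable def jobProfit {n m : ℕ} (jobs : Fin n → ℝ × ℝ × ℝ)
    (f : Fin n → Fin m) (i : Fin n) : ℝ :=
  ((jobs i).2.2 / ((jobs i).2.1 - (jobs i).1)) *
    ∫ t in (jobs i).1..(jobs i).2.1,
      ((Set.ncard { j : Fin n |
          f j = f i ∧ (jobs j).1 < t ∧ t < (jobs j).2.1 } : ℝ))⁻¹

/-- Total profit of a placement. -/
noncomputable def totalProfit {n m : ℕ} (jobs : Fin n → ℝ × ℝ × ℝ)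
    (f : Fin n → Fin m) : ℝ :=
  ∑ i : Fin n, jobProfit jobs f i

/-- Optimal offline profit. -/
noncomputable def optW (m : ℕ) {n : ℕ} (jobs : Fin n → ℝ × ℝ × ℝ) : ℝ :=
  ⨆ f : Fin n → Fin m, totalProfit jobs f

/-- A deterministic online algorithm on `m` machines assigns a machine to each
nonempty finite sequence of weighted jobs; on an instance it induces the
placement in which job `i` is assigned `A (J_1, …, J_i)`. -/
def inducedPlacementW {n : ℕ} (m : ℕ) (A : List (ℝ × ℝ × ℝ) → Fin m)
    (jobs : Fin n → ℝ × ℝ × ℝ) : Fin n → Fin m :=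
  fun i => A ((List.ofFn jobs).take (i.1 + 1))

theorem jobProfit_unitInterval {n m : ℕ} (v : Fin n → ℝ) (f : Fin n → Fin m) (i : Fin n) :
    jobProfit (fun j => ((0 : ℝ), (1 : ℝ), v j)) f i =
      v i / ({j | f j = f i} : Set (Fin n)).ncard := by
  have h : ∫ t in (0 : ℝ)..1, ((Set.ncard {j : Fin n | f j = f i ∧ (0 : ℝ) < t ∧ t < 1} : ℝ))⁻¹ =
      ∫ _ in (0 : ℝ)..1, ((Set.ncard {j : Fin n | f j = f i} : ℝ))⁻¹ := by
    simp only [intervalIntegral.integral_of_le zero_le_one, integral_Ioc_eq_integral_Ioo]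
    refine setIntegral_congr_fun measurableSet_Ioo fun t ht => ?_
    simp [ht.1, ht.2]
  simp [jobProfit, h, div_eq_mul_inv]

theorem totalProfit_unitInterval {n m : ℕ} (v : Fin n → ℝ) (f : Fin n → Fin m) :
    totalProfit (fun j => ((0 : ℝ), (1 : ℝ), v j)) f =
      ∑ i, v i / ({j | f j = f i} : Set (Fin n)).ncard := by
  simp only [totalProfit, jobProfit_unitInterval]

/-- Isolating the last job on its own machine earns at least its full profit. -/
theorem le_optW_unitInterval {k : ℕ} (v : Fin (k + 1) → ℝ) (hv : ∀ i, 0 < v i) :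
    v (Fin.last k) ≤ optW 2 (fun j => ((0 : ℝ), (1 : ℝ), v j)) := by
  let f : Fin (k + 1) → Fin 2 := fun i => if i = Fin.last k then 1 else 0
  have hf : {j | f j = f (Fin.last k)} = {Fin.last k} := by
    ext j
    by_cases hj : j = Fin.last k <;> simp [f, hj]
  calc v (Fin.last k)
      = v (Fin.last k) / ({j | f j = f (Fin.last k)} : Set (Fin (k + 1))).ncard := by simp [hf]
    _ ≤ ∑ i, v i / ({j | f j = f i} : Set (Fin (k + 1))).ncard :=
        Finset.single_le_sum (f := fun i => v i / ({j | f j = f i} : Set (Fin (k + 1))).ncard)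
          (fun i _ => div_nonneg (hv i).le (Nat.cast_nonneg _)) (Finset.mem_univ _)
    _ = totalProfit (fun j => ((0 : ℝ), (1 : ℝ), v j)) f := (totalProfit_unitInterval v f).symm
    _ ≤ _ := le_ciSup (Set.finite_range _).bddAbove f

/-- If the last of the jobs with profits `1, N + 1, (N + 1) ^ 2, …` shares its machine with at
least `N` jobs (itself included), then the total profit is at most `2 / N` times its profit. -/
theorem totalProfit_geometric_le {k m N : ℕ} (hN : 0 < N) (f : Fin (k + 1) → Fin m)
    (hf : N ≤ ({j | f j = f (Fin.last k)} : Set (Fin (k + 1))).ncard) :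
    totalProfit (fun j : Fin (k + 1) => ((0 : ℝ), (1 : ℝ), (N + 1 : ℝ) ^ (j : ℕ))) f ≤
      2 * (N + 1 : ℝ) ^ k / N := by
  have hN' : (0 : ℝ) < N := by exact_mod_cast hN
  rw [totalProfit_unitInterval (fun j : Fin (k + 1) => (N + 1 : ℝ) ^ (j : ℕ)), Fin.sum_univ_castSucc]
  have hlast : (N + 1 : ℝ) ^ k / ({j | f j = f (Fin.last k)} : Set (Fin (k + 1))).ncard ≤
      (N + 1 : ℝ) ^ k / N := by
    gcongr
  have hrest : ∑ i : Fin k, (N + 1 : ℝ) ^ (i : ℕ) /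
      ({j | f j = f i.castSucc} : Set (Fin (k + 1))).ncard ≤ (N + 1 : ℝ) ^ k / N := by
    calc _ ≤ ∑ i : Fin k, (N + 1 : ℝ) ^ (i : ℕ) := by
          refine Finset.sum_le_sum fun i _ => div_le_self (by positivity) ?_
          exact Nat.one_le_cast.2 ((Set.ncard_pos (Set.toFinite _)).2 ⟨i.castSucc, rfl⟩)
      _ = ∑ i ∈ Finset.range k, (N + 1 : ℝ) ^ i := Fin.sum_univ_eq_sum_range _ _
      _ ≤ _ := by
          rw [le_div_iff₀ hN']
          have := geom_sum_mul (N + 1 : ℝ) k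
          rw [add_sub_cancel_right] at this
          linarith
  calc _ ≤ (N + 1 : ℝ) ^ k / N + (N + 1 : ℝ) ^ k / N := add_le_add hrest hlast
    _ = _ := by ring

/-- Any two-colouring of `ℕ` has a point whose colour occurs at least `N` times up to it. -/
theorem exists_le_ncard_same_color (g : ℕ → Fin 2) {N : ℕ} (hN : 0 < N) :
    ∃ k, N ≤ ({j | g j = g k} : Set (Fin (k + 1))).ncard := by
  obtain ⟨b, -, hb⟩ := Finset.exists_le_card_fiber_of_mul_le_card_of_maps_to
    (s := Finset.range (2 * N)) (t := Finset.univ) (f := g) (n := N)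
    (fun _ _ => Finset.mem_univ _) Finset.univ_nonempty (by simp)
  set s := (Finset.range (2 * N)).filter (fun x => g x = b) with hs
  have hne : s.Nonempty := Finset.card_pos.1 (hN.trans_le hb)
  have hk := s.max'_mem hne
  set k := s.max' hne
  have hgk : g k = b := (Finset.mem_filter.1 hk).2
  refine ⟨k, hb.trans ?_⟩
  rw [← Set.ncard_coe_finset, ← Set.ncard_image_of_injective _ (Fin.val_injective (n := k + 1))]
  refine Set.ncard_le_ncard (fun x hx => ?_) (Set.toFinite _)
  exact ⟨⟨x, Nat.lt_succ_of_le (s.le_max' x hx)⟩, (Finset.mem_filter.1 hx).2.trans hgk.symm, rfl⟩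

theorem inducedPlacementW_of_sequence {n : ℕ} (m : ℕ) (A : List (ℝ × ℝ × ℝ) → Fin m)
    (J : ℕ → ℝ × ℝ × ℝ) (i : Fin n) :
    inducedPlacementW m A (fun j : Fin n => J j) i = A ((List.range (i + 1)).map J) := by
  unfold inducedPlacementW
  congr 1
  exact List.ext_getElem (by simp) fun l h₁ h₂ => by simp

/-- No bounded competitive ratio with general profits on two machines: for
every deterministic online algorithm `A` and every `c > 0` there is an
instance `σ` with `OPT(σ) > c · V_A(σ)`. -/
theorem no_competitive_online_two_machines (A : List (ℝ × ℝ × ℝ) → Fin 2)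
    (c : ℝ) (hc : 0 < c) :
    ∃ (n : ℕ), 0 < n ∧ ∃ jobs : Fin n → ℝ × ℝ × ℝ,
      (∀ i, (jobs i).1 < (jobs i).2.1 ∧ 0 < (jobs i).2.2) ∧
      c * totalProfit jobs (inducedPlacementW 2 A jobs) < optW 2 jobs := by
  obtain ⟨N, hN⟩ := exists_nat_gt (2 * c)
  have hN' : (0 : ℝ) < N := by linarith
  have hNpos : 0 < N := by exact_mod_cast hN'
  let J : ℕ → ℝ × ℝ × ℝ := fun i => (0, 1, (N + 1 : ℝ) ^ i)
  obtain ⟨k, hk⟩ :=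
    exists_le_ncard_same_color (fun i => A ((List.range (i + 1)).map J)) hNpos
  refine ⟨k + 1, k.succ_pos, fun j => J j, fun i => ⟨zero_lt_one, by positivity⟩, ?_⟩
  have hpl : N ≤ ({j | inducedPlacementW 2 A (fun j : Fin (k + 1) => J j) j =
      inducedPlacementW 2 A (fun j : Fin (k + 1) => J j) (Fin.last k)} :
        Set (Fin (k + 1))).ncard := by
    simpa only [inducedPlacementW_of_sequence, Fin.val_last] using hk
  calc c * totalProfit (fun j : Fin (k + 1) => J j) _
      ≤ c * (2 * (N + 1 : ℝ) ^ k / N) := by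
        gcongr
        exact totalProfit_geometric_le hNpos _ hpl
    _ = 2 * c / N * (N + 1 : ℝ) ^ k := by ring
    _ < 1 * (N + 1 : ℝ) ^ k := by
        gcongr
        exact (div_lt_one hN').2 hN
    _ = (N + 1 : ℝ) ^ k := one_mul _
    _ ≤ _ := le_optW_unitInterval (fun j : Fin (k + 1) => (N + 1 : ℝ) ^ (j : ℕ))
        fun _ => by positivity
end

section
/- (Theorem: no bounded competitive ratio with general profits, any number of machines.) For every m ≥ 2 in the general profit model, for every deterministic online algorithm A on m machines and every constant c > 0 there exists an instance σ with OPT(σ) > c · V_A(σ). In other words, for every m there is no competitive deterministic online algorithm. -/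
open MeasureTheory

/-- When all jobs share the interval `(0, 1)`, a job earns its profit divided by the number of
jobs on its machine. -/
theorem jobProfit_of_unit_interval {n m : ℕ} (v : Fin n → ℝ) (f : Fin n → Fin m) (i : Fin n) :
    jobProfit (fun j => (0, 1, v j)) f i = v i * ((Set.ncard {j | f j = f i} : ℝ))⁻¹ := by
  have h : ∫ t in (0 : ℝ)..1,
      ((Set.ncard {j : Fin n | f j = f i ∧ (0 : ℝ) < t ∧ t < (1 : ℝ)} : ℝ))⁻¹
      = ∫ _t in (0 : ℝ)..1, ((Set.ncard {j | f j = f i} : ℝ))⁻¹ := by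
    rw [intervalIntegral.integral_of_le zero_le_one, intervalIntegral.integral_of_le zero_le_one,
      integral_Ioc_eq_integral_Ioo, integral_Ioc_eq_integral_Ioo]
    refine setIntegral_congr_fun measurableSet_Ioo fun t ht => ?_
    simp [ht.1, ht.2]
  simp only [jobProfit, h]
  simp

theorem jobProfit_of_unit_interval_le {n m : ℕ} (v : Fin n → ℝ) (f : Fin n → Fin m) (i : Fin n)
    (hv : 0 ≤ v i) : jobProfit (fun j => (0, 1, v j)) f i ≤ v i := by
  rw [jobProfit_of_unit_interval]
  exact mul_le_of_le_one_right hv (Nat.cast_inv_le_one _)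

/-- With at least two machines, one job can be given a machine of its own. -/
theorem le_optW_of_unit_interval {n m : ℕ} (hm : 2 ≤ m) (v : Fin n → ℝ) (hv : ∀ i, 0 ≤ v i)
    (i : Fin n) : v i ≤ optW m (fun j => (0, 1, v j)) := by
  let f : Fin n → Fin m := fun j => if j = i then ⟨0, by omega⟩ else ⟨1, by omega⟩
  have hcard : {j | f j = f i} = {i} := by
    ext j
    by_cases hj : j = i <;> simp [f, hj]
  have hi : jobProfit (fun j => (0, 1, v j)) f i = v i := by
    rw [jobProfit_of_unit_interval, hcard]
    simp
  calc v i = jobProfit (fun j => (0, 1, v j)) f i := hi.symm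
    _ ≤ totalProfit (fun j => (0, 1, v j)) f :=
        Finset.single_le_sum (f := jobProfit (fun j => (0, 1, v j)) f)
          (fun j _ => by
            rw [jobProfit_of_unit_interval]
            exact mul_nonneg (hv j) (by positivity)) (Finset.mem_univ i)
    _ ≤ optW m (fun j => (0, 1, v j)) :=
        le_ciSup (f := totalProfit (fun j => (0, 1, v j))) (Set.finite_range _).bddAbove f

/-- A sequence of values in a finite type takes some value arbitrarily often. -/
theorem exists_le_ncard_fiber {α : Type*} [Finite α] (g : ℕ → α) (N : ℕ) :
    ∃ n, N ≤ Set.ncard {j : Fin (n + 1) | g j = g n} := by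
  obtain ⟨a, ha⟩ := Finite.exists_infinite_fiber g
  obtain ⟨s, hs, hcard⟩ := (Set.infinite_coe_iff.mp ha).exists_subset_card_eq (N + 1)
  have hne : s.Nonempty := Finset.card_pos.mp (by omega)
  have hmem : ∀ k ∈ s, g k = a := fun k hk => hs hk
  refine ⟨s.max' hne, ?_⟩
  have hsub : (s : Set ℕ) ⊆
      Fin.val '' {j : Fin (s.max' hne + 1) | g j = g (s.max' hne)} := fun k hk =>
    ⟨⟨k, Nat.lt_succ_of_le (s.le_max' k hk)⟩,
      (hmem k hk).trans (hmem _ (s.max'_mem hne)).symm, rfl⟩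
  have h := Set.ncard_le_ncard hsub (Set.toFinite _)
  rw [Set.ncard_coe_finset, Set.ncard_image_of_injective _ Fin.val_injective] at h
  omega

/-- On an initial segment of a fixed infinite job sequence, the placement induced by an online algorithm
does not depend on the length of the segment. -/
theorem inducedPlacementW_initial {m : ℕ} (A : List (ℝ × ℝ × ℝ) → Fin m) (J : ℕ → ℝ × ℝ × ℝ)
    (n : ℕ) (i : Fin n) :
    inducedPlacementW m A (fun j : Fin n => J j) i = A (List.ofFn fun j : Fin (i + 1) => J j) := by
  unfold inducedPlacementW
  congr 1
  refine List.ext_getElem (by simp) fun k _ _ => ?_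
  simp only [List.getElem_take, List.getElem_ofFn]

/-- No bounded competitive ratio with general profits, for any number of
machines `m ≥ 2`: for every deterministic online algorithm `A` on `m` machines
and every `c > 0` there is an instance `σ` with `OPT(σ) > c · V_A(σ)`. -/
theorem no_competitive_online (m : ℕ) (hm : 2 ≤ m)
    (A : List (ℝ × ℝ × ℝ) → Fin m) (c : ℝ) (hc : 0 < c) :
    ∃ (n : ℕ), 0 < n ∧ ∃ jobs : Fin n → ℝ × ℝ × ℝ,
      (∀ i, (jobs i).1 < (jobs i).2.1 ∧ 0 < (jobs i).2.2) ∧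
      c * totalProfit jobs (inducedPlacementW m A jobs) < optW m jobs := by
  set K : ℝ := 1 + 4 * c with hK
  have hKpos : 0 < K := by positivity
  let J : ℕ → ℝ × ℝ × ℝ := fun i => (0, 1, K ^ i)
  let g : ℕ → Fin m := fun i => A (List.ofFn fun j : Fin (i + 1) => J j)
  obtain ⟨N, hN⟩ := exists_nat_gt (2 * c)
  obtain ⟨n, hn⟩ := exists_le_ncard_fiber g N
  let v : Fin (n + 1) → ℝ := fun i => K ^ (i : ℕ)
  have hv : ∀ i, 0 < v i := fun i => pow_pos hKpos _
  refine ⟨n + 1, n.succ_pos, fun i => (0, 1, v i), fun i => ⟨one_pos, hv i⟩, ?_⟩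
  have hf : inducedPlacementW m A (fun i : Fin (n + 1) => (0, 1, v i)) = fun i : Fin (n + 1) => g i :=
    funext fun i => inducedPlacementW_initial A J (n + 1) i
  refine lt_of_lt_of_le ?_ (le_optW_of_unit_interval hm v (fun i => (hv i).le) (Fin.last n))
  rw [hf, totalProfit, Fin.sum_univ_castSucc]
  have hsmall : ∑ i : Fin n, jobProfit (fun j => (0, 1, v j)) (fun i => g i) i.castSucc
      ≤ (K ^ n - 1) / (K - 1) := by
    rw [← geom_sum_eq (by linarith), ← Fin.sum_univ_eq_sum_range (fun i => K ^ i)]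
    exact Finset.sum_le_sum fun i _ => jobProfit_of_unit_interval_le v _ i.castSucc (hv _).le
  have hlast : jobProfit (fun j => (0, 1, v j)) (fun i => g i) (Fin.last n) ≤ K ^ n * (2 * c)⁻¹ := by
    rw [jobProfit_of_unit_interval]
    have hle : 2 * c ≤ (Set.ncard {j : Fin (n + 1) | g j = g n} : ℝ) :=
      hN.le.trans (by exact_mod_cast hn)
    exact mul_le_mul_of_nonneg_left (inv_anti₀ (by positivity) hle) (hv _).le
  have hpow : 0 < K ^ n := pow_pos hKpos n
  calc _ ≤ c * ((K ^ n - 1) / (K - 1) + K ^ n * (2 * c)⁻¹) :=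
        mul_le_mul_of_nonneg_left (add_le_add hsmall hlast) hc.le
    _ = (K ^ n - 1) / 4 + K ^ n / 2 := by
        rw [show K - 1 = 4 * c by rw [hK]; ring]
        field_simp
    _ < K ^ n := by linarith
end

section
/- (First adversary instance for two machines.) Let x > 0 and consider the instance on m = 2 machines consisting of the jobs J_1 = [0, 1], J_2 = [1 + x, 2 + x], J_3 = [0, 2 + x] in the uniform profit case. Then OPT(σ) = 4 + x, and every placement f with f(1) ≠ f(2) satisfies V(f) = 3 + x. -/
open MeasureTheory

/-- The profit of a placement of three jobs on two machines, with the unions written out. -/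
theorem profit_three_two (jobs : Fin 3 → ℝ × ℝ) (f : Fin 3 → Fin 2) :
    profit jobs f = ∑ a : Fin 2, (volume
      ((⋃ (_ : f 0 = a), Set.Icc (jobs 0).1 (jobs 0).2) ∪
        (⋃ (_ : f 1 = a), Set.Icc (jobs 1).1 (jobs 1).2) ∪
        (⋃ (_ : f 2 = a), Set.Icc (jobs 2).1 (jobs 2).2))).toReal := by
  simp only [profit, iUnion_fin_three]

/-- The profit of every placement in the first adversary instance. -/
theorem profit_adversary (x : ℝ) (hx : 0 < x) (f : Fin 3 → Fin 2) :
    profit ![(0, 1), (1 + x, 2 + x), (0, 2 + x)] f =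
      if f 0 = f 1 then (if f 2 = f 0 then 2 + x else 4 + x) else 3 + x := by
  have hshort : Set.Icc (0 : ℝ) 1 ∪ Set.Icc 0 (2 + x) = Set.Icc 0 (2 + x) :=
    Set.union_eq_right.2 (Set.Icc_subset_Icc le_rfl (by linarith))
  have hlate : Set.Icc (1 + x) (2 + x) ∪ Set.Icc 0 (2 + x) = Set.Icc 0 (2 + x) :=
    Set.union_eq_right.2 (Set.Icc_subset_Icc (by linarith) le_rfl)
  have hdisj : Disjoint (Set.Icc (0 : ℝ) 1) (Set.Icc (1 + x) (2 + x)) :=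
    Set.disjoint_left.2 fun y h h' => by linarith [h.2, h'.1]
  have hlong : (volume (Set.Icc 0 (2 + x))).toReal = 2 + x := by
    rw [Real.volume_Icc, ENNReal.toReal_ofReal (by linarith), sub_zero]
  have hone : (volume (Set.Icc (0 : ℝ) 1)).toReal = 1 := by simp
  have hone' : (volume (Set.Icc (1 + x) (2 + x))).toReal = 1 := by
    rw [Real.volume_Icc, ENNReal.toReal_ofReal (by linarith)]
    ring
  have htwo : (volume (Set.Icc (0 : ℝ) 1 ∪ Set.Icc (1 + x) (2 + x))).toReal = 2 := by
    rw [measure_union hdisj measurableSet_Icc, ENNReal.toReal_add (by simp) (by simp), hone, hone']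
    norm_num
  rw [profit_three_two, Fin.sum_univ_two]
  generalize f 0 = p, f 1 = q, f 2 = r
  fin_cases p <;> fin_cases q <;> fin_cases r <;>
    simp [-Real.volume_Icc, Set.union_assoc, hshort, hlate, hlong, hone, hone', htwo] <;> ring

/-- First adversary instance for two machines: with jobs `[0,1]`, `[1+x,2+x]`,
`[0,2+x]`, the optimum is `4 + x` and every placement putting the first two
jobs on different machines has profit `3 + x`. -/
theorem first_adversary_instance (x : ℝ) (hx : 0 < x)
    (jobs : Fin 3 → ℝ × ℝ)
    (hjobs : jobs = ![(0, 1), (1 + x, 2 + x), (0, 2 + x)]) :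
    opt 2 jobs = 4 + x ∧
      ∀ f : Fin 3 → Fin 2, f 0 ≠ f 1 → profit jobs f = 3 + x := by
  subst hjobs
  refine ⟨le_antisymm (ciSup_le fun f => ?_) ?_, fun f hf => ?_⟩
  · rw [profit_adversary x hx]
    split_ifs <;> linarith
  · refine le_ciSup_of_le (Set.finite_range _).bddAbove ![0, 0, 1] ?_
    simp [profit_adversary x hx]
  · rw [profit_adversary x hx, if_neg hf]
end

section
/- (Second adversary instance for two machines.) Let 0 < x ≤ 1 and consider the instance on m = 2 machines consisting of the jobs J_1 = [0, 1], J_2 = [1 + x, 2 + x], J_3 = [1 − x, 1 + x], J_4 = [1, 1 + 2x] in the uniform profit case. Then OPT(σ) = 2 + 4x, and every placement f with f(1) = f(2) satisfies V(f) ≤ 2 + 3x. -/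
open MeasureTheory

/-- The profit collected by machine `a` under the placement `f`. -/
noncomputable def load {n m : ℕ} (jobs : Fin n → ℝ × ℝ) (f : Fin n → Fin m) (a : Fin m) : ℝ :=
  (volume (⋃ i : Fin n, ⋃ (_ : f i = a), Set.Icc (jobs i).1 (jobs i).2)).toReal

theorem profit_eq_sum_load {n m : ℕ} (jobs : Fin n → ℝ × ℝ) (f : Fin n → Fin m) :
    profit jobs f = ∑ a : Fin m, load jobs f a := rfl

theorem load_le_sum {n m : ℕ} (jobs : Fin n → ℝ × ℝ) (h : ∀ i, (jobs i).1 ≤ (jobs i).2)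
    (f : Fin n → Fin m) (a : Fin m) :
    load jobs f a ≤ ∑ i : Fin n, if f i = a then (jobs i).2 - (jobs i).1 else 0 := by
  refine (measureReal_iUnion_fintype_le _).trans (Finset.sum_le_sum fun i _ => ?_)
  split_ifs with hi
  · simp [hi, h i]
  · simp [hi]

theorem load_le_of_forall_mem {n m : ℕ} (jobs : Fin n → ℝ × ℝ) (f : Fin n → Fin m) (a : Fin m)
    {p q : ℝ} (hpq : p ≤ q) (h : ∀ i, f i = a → p ≤ (jobs i).1 ∧ (jobs i).2 ≤ q) :
    load jobs f a ≤ q - p := by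
  have hsub : (⋃ i : Fin n, ⋃ (_ : f i = a), Set.Icc (jobs i).1 (jobs i).2) ⊆ Set.Icc p q :=
    Set.iUnion₂_subset fun i hi => Set.Icc_subset_Icc (h i hi).1 (h i hi).2
  rw [← Real.volume_real_Icc_of_le hpq]
  exact measureReal_mono hsub measure_Icc_lt_top.ne

theorem le_load_of_subset {n m : ℕ} (jobs : Fin n → ℝ × ℝ) (f : Fin n → Fin m) (a : Fin m)
    {p q : ℝ} (hpq : p ≤ q)
    (h : Set.Icc p q ⊆ ⋃ i : Fin n, ⋃ (_ : f i = a), Set.Icc (jobs i).1 (jobs i).2) :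
    q - p ≤ load jobs f a := by
  rw [← Real.volume_real_Icc_of_le hpq]
  refine measureReal_mono h (ne_of_lt ?_)
  have hc : IsCompact (⋃ i : Fin n, ⋃ (_ : f i = a), Set.Icc (jobs i).1 (jobs i).2) :=
    isCompact_iUnion fun i => isCompact_iUnion fun _ => isCompact_Icc
  exact hc.measure_lt_top

theorem profit_le_sum {n m : ℕ} (jobs : Fin n → ℝ × ℝ) (h : ∀ i, (jobs i).1 ≤ (jobs i).2)
    (f : Fin n → Fin m) : profit jobs f ≤ ∑ i : Fin n, ((jobs i).2 - (jobs i).1) := by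
  rw [profit_eq_sum_load]
  refine (Finset.sum_le_sum fun a _ => load_le_sum jobs h f a).trans ?_
  rw [Finset.sum_comm]
  simp

/-- Second adversary instance for two machines: with jobs `[0,1]`, `[1+x,2+x]`,
`[1−x,1+x]`, `[1,1+2x]` for `0 < x ≤ 1`, the optimum is `2 + 4x` and every
placement putting the first two jobs on the same machine has profit
at most `2 + 3x`. -/
theorem second_adversary_instance (x : ℝ) (hx0 : 0 < x) (hx1 : x ≤ 1)
    (jobs : Fin 4 → ℝ × ℝ)
    (hjobs : jobs = ![(0, 1), (1 + x, 2 + x), (1 - x, 1 + x), (1, 1 + 2 * x)]) :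
    opt 2 jobs = 2 + 4 * x ∧
      ∀ f : Fin 4 → Fin 2, f 0 = f 1 → profit jobs f ≤ 2 + 3 * x := by
  have hle : ∀ i, (jobs i).1 ≤ (jobs i).2 := by
    subst hjobs
    simp [Fin.forall_fin_succ]
    constructor <;> linarith
  refine ⟨le_antisymm (ciSup_le fun f => ?_) ?_, fun f hf => ?_⟩
  · refine (profit_le_sum jobs hle f).trans (le_of_eq ?_)
    subst hjobs
    simp [Fin.sum_univ_four]
    ring
  · refine le_trans ?_ (le_ciSup (Set.finite_range _).bddAbove (![0, 1, 1, 0] : Fin 4 → Fin 2))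
    have h0 : 1 + 2 * x - 0 ≤ load jobs (![0, 1, 1, 0] : Fin 4 → Fin 2) 0 := by
      refine le_load_of_subset _ _ _ (by linarith) fun y hy => ?_
      simp only [Set.mem_iUnion]
      subst hjobs
      rcases le_total y 1 with h | h
      · exact ⟨0, rfl, hy.1, h⟩
      · exact ⟨3, rfl, h, hy.2⟩
    have h1 : 2 + x - (1 - x) ≤ load jobs (![0, 1, 1, 0] : Fin 4 → Fin 2) 1 := by
      refine le_load_of_subset _ _ _ (by linarith) fun y hy => ?_
      simp only [Set.mem_iUnion]
      subst hjobs
      rcases le_total y (1 + x) with h | h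
      · exact ⟨2, rfl, hy.1, h⟩
      · exact ⟨1, rfl, h, hy.2⟩
    rw [profit_eq_sum_load, Fin.sum_univ_two]
    linarith
  · obtain ⟨b, hb, hsum⟩ : ∃ b, f 0 ≠ b ∧ profit jobs f = load jobs f (f 0) + load jobs f b := by
      rw [profit_eq_sum_load, Fin.sum_univ_two]
      generalize f 0 = a
      fin_cases a
      · exact ⟨1, by simp, rfl⟩
      · exact ⟨0, by simp, add_comm _ _⟩
    have hb' : f 1 ≠ b := hf ▸ hb
    have hall : load jobs f (f 0) ≤ 2 + x - 0 := by
      refine load_le_of_forall_mem _ _ _ (by linarith) fun i _ => ?_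
      subst hjobs
      fin_cases i <;> constructor <;> simp <;> linarith
    have hsa := load_le_sum jobs hle f (f 0)
    have hsb := load_le_sum jobs hle f b
    rw [hsum]
    by_cases h : f 2 = b ∧ f 3 = b
    · have hboth : load jobs f b ≤ 1 + 2 * x - (1 - x) := by
        refine load_le_of_forall_mem _ _ _ (by linarith) fun i hi => ?_
        subst hjobs
        fin_cases i
        · exact absurd hi hb
        · exact absurd hi hb'
        · constructor <;> simp; linarith
        · constructor <;> simp; linarith
      have hpair : load jobs f (f 0) ≤ 2 := by
        refine hsa.trans (le_of_eq ?_)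
        simp [Fin.sum_univ_four, hjobs, h.1, h.2, hf, hb'.symm]
      linarith
    · have hone : load jobs f b ≤ 2 * x := by
        refine hsb.trans ?_
        simp only [Fin.sum_univ_four, hjobs, hb, hb', if_false]
        split_ifs with h2 h3 h3
        · exact absurd ⟨h2, h3⟩ h
        all_goals simp; try linarith
      linarith
end

section
/- (Lower bound for every deterministic online algorithm, four machines.) For m = 4 machines in the uniform profit case, for every deterministic online algorithm A there exists an instance σ with OPT(σ) ≥ ((22 − 2√2)/17) · V_A(σ); note (22 − 2√2)/17 > 1.127. -/
open MeasureTheory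

/-- A deterministic online algorithm on `m` machines: a function assigning to
each (nonempty) finite sequence of jobs a machine.  On an instance it is fed,
for each job `i`, the prefix `J_1, …, J_i`. -/
def inducedPlacement {n : ℕ} (m : ℕ) (A : List (ℝ × ℝ) → Fin m)
    (jobs : Fin n → ℝ × ℝ) : Fin n → Fin m :=
  fun i => A ((List.ofFn jobs).take (i.1 + 1))

/-- If the jobs on each machine are covered by intervals assigned to that machine, then the total
length of these intervals bounds the profit. -/
lemma profit_le_sum_length {n m : ℕ} (jobs cover : Fin n → ℝ × ℝ) (f : Fin n → Fin m)
    (hle : ∀ k, (cover k).1 ≤ (cover k).2)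
    (hcover : ∀ i, ∀ x ∈ Set.Icc (jobs i).1 (jobs i).2,
      ∃ k, f k = f i ∧ x ∈ Set.Icc (cover k).1 (cover k).2) :
    profit jobs f ≤ ∑ k, ((cover k).2 - (cover k).1) := by
  have hmachine : ∀ a : Fin m,
      (volume (⋃ i : Fin n, ⋃ (_ : f i = a), Set.Icc (jobs i).1 (jobs i).2)).toReal
        ≤ ∑ k, if f k = a then (cover k).2 - (cover k).1 else 0 := by
    intro a
    have hsub : (⋃ i : Fin n, ⋃ (_ : f i = a), Set.Icc (jobs i).1 (jobs i).2)
        ⊆ ⋃ k ∈ Finset.univ.filter (fun k => f k = a), Set.Icc (cover k).1 (cover k).2 := by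
      intro x hx
      simp only [Set.mem_iUnion] at hx
      obtain ⟨i, hi, hx⟩ := hx
      obtain ⟨k, hk, hxk⟩ := hcover i x hx
      simp only [Set.mem_iUnion, Finset.mem_filter, Finset.mem_univ, true_and]
      exact ⟨k, hk.trans hi, hxk⟩
    refine ENNReal.toReal_le_of_le_ofReal
      (Finset.sum_nonneg fun k _ => by split_ifs <;> linarith [hle k]) ?_
    refine (measure_mono hsub).trans ((measure_biUnion_finset_le _ _).trans ?_)
    rw [← Finset.sum_filter, ENNReal.ofReal_sum_of_nonneg fun k _ => sub_nonneg.2 (hle k)]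
    simp [Real.volume_Icc]
  refine (Finset.sum_le_sum fun a _ => hmachine a).trans ?_
  rw [Finset.sum_comm]
  simp

/-- A placement in which each machine `a` is busy throughout an interval `goal a` certifies a lower
bound on the optimal profit. -/
lemma sum_length_le_opt {n m : ℕ} (jobs : Fin n → ℝ × ℝ) (f : Fin n → Fin m)
    (goal : Fin m → ℝ × ℝ)
    (hgoal : ∀ a, ∀ x ∈ Set.Icc (goal a).1 (goal a).2,
      ∃ i, f i = a ∧ x ∈ Set.Icc (jobs i).1 (jobs i).2) :
    ∑ a, ((goal a).2 - (goal a).1) ≤ opt m jobs := by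
  refine le_trans ?_ (le_ciSup (Set.finite_range _).bddAbove f)
  refine Finset.sum_le_sum fun a _ => ?_
  have hsub : Set.Icc (goal a).1 (goal a).2
      ⊆ ⋃ i : Fin n, ⋃ (_ : f i = a), Set.Icc (jobs i).1 (jobs i).2 := by
    intro x hx
    simpa only [Set.mem_iUnion, exists_prop] using hgoal a x hx
  have hfin : volume (⋃ i : Fin n, ⋃ (_ : f i = a), Set.Icc (jobs i).1 (jobs i).2) ≠ ⊤ :=
    (isCompact_iUnion fun i => isCompact_iUnion fun _ => isCompact_Icc).measure_lt_top.ne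
  refine le_trans ?_ (ENNReal.toReal_mono hfin (measure_mono hsub))
  rw [Real.volume_Icc, ENNReal.toReal_ofReal']
  exact le_max_left _ _

/-- Two copies of `[0, 2]` followed by two copies of `[1, 3]`. -/
def fourJobs : Fin 4 → ℝ × ℝ := ![(0, 2), (0, 2), (1, 3), (1, 3)]

/-- `fourJobs` followed by two copies of `[0, 3]`. -/
def sixJobs : Fin 6 → ℝ × ℝ := ![(0, 2), (0, 2), (1, 3), (1, 3), (0, 3), (0, 3)]

lemma eight_le_opt_fourJobs : 8 ≤ opt 4 fourJobs := by
  have h := sum_length_le_opt fourJobs id fourJobs fun a x hx => ⟨a, rfl, hx⟩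
  norm_num [fourJobs, Fin.sum_univ_succ] at h ⊢
  linarith

lemma twelve_le_opt_sixJobs : 12 ≤ opt 4 sixJobs := by
  have h := sum_length_le_opt (m := 4) sixJobs ![0, 1, 0, 1, 2, 3] (fun _ => (0, 3)) (by
    have hcover : ∀ x : ℝ, x ∈ Set.Icc (0 : ℝ) 3 → x ≤ 2 ∨ 1 ≤ x := fun x _ => by
      rcases le_total x 2 with h | h
      · exact Or.inl h
      · exact Or.inr (by linarith)
    intro a x hx
    have hx0 : 0 ≤ x := hx.1
    have hx3 : x ≤ 3 := hx.2
    fin_cases a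
    · rcases hcover x hx with h | h
      · exact ⟨0, rfl, by simp [sixJobs, *]⟩
      · exact ⟨2, rfl, by simp [sixJobs, *]⟩
    · rcases hcover x hx with h | h
      · exact ⟨1, rfl, by simp [sixJobs, *]⟩
      · exact ⟨3, rfl, by simp [sixJobs, *]⟩
    · exact ⟨4, rfl, by simp [sixJobs, *]⟩
    · exact ⟨5, rfl, by simp [sixJobs, *]⟩)
  norm_num at h
  exact h

lemma profit_fourJobs_le {m : ℕ} (f : Fin 4 → Fin m) (hf : ¬ Function.Injective f) :
    profit fourJobs f ≤ 7 := by
  simp only [Function.Injective, not_forall] at hf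
  obtain ⟨i, j, hij, hne⟩ := hf
  let rest : Fin 4 → ℝ × ℝ := ![(0, 1), (0, 1), (2, 3), (2, 3)]
  have h := profit_le_sum_length fourJobs (Function.update fourJobs j (rest j)) f
    (by
      intro k
      rcases eq_or_ne k j with rfl | hk
      · fin_cases k <;> norm_num [rest]
      · rw [Function.update_of_ne hk]
        fin_cases k <;> norm_num [fourJobs])
    (by
      intro k x hx
      rcases eq_or_ne k j with rfl | hk
      · by_cases hmid : x ∈ Set.Icc (1 : ℝ) 2
        · refine ⟨i, hij, ?_⟩
          rw [Function.update_of_ne hne]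
          obtain ⟨h1, h2⟩ := hmid
          fin_cases i <;> constructor <;> norm_num [fourJobs] <;> linarith
        · refine ⟨k, rfl, ?_⟩
          rw [Function.update_self]
          have hmid' : x < 1 ∨ 2 < x := by
            by_contra! hcon
            exact hmid hcon
          fin_cases k <;> simp [fourJobs, rest] at hx ⊢ <;>
            rcases hmid' with h | h <;> constructor <;> linarith
      · exact ⟨k, rfl, by rwa [Function.update_of_ne hk]⟩)
  have hlength : ∀ k, (Function.update fourJobs j (rest j) k).2
      - (Function.update fourJobs j (rest j) k).1 = 2 - if k = j then (1 : ℝ) else 0 := by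
    intro k
    rcases eq_or_ne k j with rfl | hk
    · rw [Function.update_self, if_pos rfl]
      fin_cases k <;> norm_num [rest]
    · rw [Function.update_of_ne hk, if_neg hk]
      fin_cases k <;> norm_num [fourJobs]
  rw [Finset.sum_congr rfl fun k _ => hlength k, Finset.sum_sub_distrib] at h
  norm_num at h
  exact h

lemma profit_sixJobs_le {m : ℕ} (f : Fin 6 → Fin m)
    (hf : ∀ k, ∃ i : Fin 4, f (Fin.castLE (by norm_num) i) = f k) :
    profit sixJobs f ≤ 10 := by
  have hrest : ∀ k, ∃ c : ℝ × ℝ, c.2 - c.1 = 1 ∧ ∀ x ∈ Set.Icc (0 : ℝ) 3,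
      x ∈ Set.Icc c.1 c.2 ∨ ∃ i : Fin 4, f (Fin.castLE (by norm_num) i) = f k ∧
        x ∈ Set.Icc (fourJobs i).1 (fourJobs i).2 := by
    intro k
    obtain ⟨i, hi⟩ := hf k
    have hsplit : ∃ c : ℝ × ℝ, c.2 - c.1 = 1 ∧ ∀ x ∈ Set.Icc (0 : ℝ) 3,
        x ∈ Set.Icc c.1 c.2 ∨ x ∈ Set.Icc (fourJobs i).1 (fourJobs i).2 := by
      have hleft : ∀ x ∈ Set.Icc (0 : ℝ) 3, x ∈ Set.Icc (2 : ℝ) 3 ∨ x ∈ Set.Icc (0 : ℝ) 2 :=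
        fun x hx => (le_total 2 x).imp (fun h => ⟨h, hx.2⟩) (fun h => ⟨hx.1, h⟩)
      have hright : ∀ x ∈ Set.Icc (0 : ℝ) 3, x ∈ Set.Icc (0 : ℝ) 1 ∨ x ∈ Set.Icc (1 : ℝ) 3 :=
        fun x hx => (le_total x 1).imp (fun h => ⟨hx.1, h⟩) (fun h => ⟨h, hx.2⟩)
      fin_cases i
      · exact ⟨(2, 3), by norm_num, hleft⟩
      · exact ⟨(2, 3), by norm_num, hleft⟩
      · exact ⟨(0, 1), by norm_num, hright⟩
      · exact ⟨(0, 1), by norm_num, hright⟩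
    obtain ⟨c, hc, hx⟩ := hsplit
    exact ⟨c, hc, fun x h => (hx x h).imp id fun h => ⟨i, hi, h⟩⟩
  obtain ⟨c, hc, hcx⟩ := hrest 4
  obtain ⟨d, hd, hdx⟩ := hrest 5
  let cover : Fin 6 → ℝ × ℝ := ![(0, 2), (0, 2), (1, 3), (1, 3), c, d]
  have hcast : ∀ i : Fin 4, fourJobs i = cover (Fin.castLE (by norm_num) i) := by
    intro i
    fin_cases i <;> rfl
  have h := profit_le_sum_length sixJobs cover f
    (by
      intro k
      fin_cases k <;> simp [cover] <;> linarith)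
    (by
      intro k x hx
      fin_cases k
      · exact ⟨0, rfl, hx⟩
      · exact ⟨1, rfl, hx⟩
      · exact ⟨2, rfl, hx⟩
      · exact ⟨3, rfl, hx⟩
      · rcases hcx x hx with h | ⟨i, hi, h⟩
        · exact ⟨4, rfl, h⟩
        · exact ⟨_, hi, hcast i ▸ h⟩
      · rcases hdx x hx with h | ⟨i, hi, h⟩
        · exact ⟨5, rfl, h⟩
        · exact ⟨_, hi, hcast i ▸ h⟩)
  refine h.trans ?_
  rw [Fin.sum_univ_six]
  change (2 - 0) + (2 - 0) + (3 - 1) + (3 - 1) + (c.2 - c.1) + (d.2 - d.1) ≤ (10 : ℝ)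
  linarith

lemma inducedPlacement_sixJobs_castLE {m : ℕ} (A : List (ℝ × ℝ) → Fin m) (i : Fin 4) :
    inducedPlacement m A sixJobs (Fin.castLE (by norm_num) i) =
      inducedPlacement m A fourJobs i := by
  fin_cases i <;> simp [inducedPlacement, sixJobs, fourJobs, List.ofFn_succ]

/-- Lower bound for every deterministic online algorithm on four machines:
there is an instance with `OPT(σ) ≥ ((22 − 2√2)/17) · V_A(σ)`. -/
theorem online_lower_bound_four_machines (A : List (ℝ × ℝ) → Fin 4) :
    ∃ (n : ℕ), 0 < n ∧ ∃ jobs : Fin n → ℝ × ℝ,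
      (∀ i, (jobs i).1 < (jobs i).2) ∧
      ((22 - 2 * Real.sqrt 2) / 17) * profit jobs (inducedPlacement 4 A jobs)
        ≤ opt 4 jobs := by
  have hratio : (22 - 2 * Real.sqrt 2) / 17 ≤ 8 / 7 := by
    have : (9 / 7 : ℝ) ≤ Real.sqrt 2 := Real.le_sqrt_of_sq_le (by norm_num)
    linarith
  have hprofit : ∀ {n : ℕ} (jobs : Fin n → ℝ × ℝ) (f : Fin n → Fin 4), 0 ≤ profit jobs f :=
    fun jobs f => Finset.sum_nonneg fun a _ => ENNReal.toReal_nonneg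
  by_cases hinj : Function.Injective (inducedPlacement 4 A fourJobs)
  · refine ⟨6, by norm_num, sixJobs, fun i => by fin_cases i <;> norm_num [sixJobs], ?_⟩
    have hle := profit_sixJobs_le (inducedPlacement 4 A sixJobs) fun k => by
      obtain ⟨i, hi⟩ := Finite.surjective_of_injective hinj (inducedPlacement 4 A sixJobs k)
      exact ⟨i, (inducedPlacement_sixJobs_castLE A i).trans hi⟩
    refine (mul_le_mul_of_nonneg_right hratio (hprofit _ _)).trans ?_
    linarith [twelve_le_opt_sixJobs]
  · refine ⟨4, by norm_num, fourJobs, fun i => by fin_cases i <;> norm_num [fourJobs], ?_⟩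
    refine (mul_le_mul_of_nonneg_right hratio (hprofit _ _)).trans ?_
    linarith [eight_le_opt_fourJobs, profit_fourJobs_le _ hinj]
end

section
/- (Lower bound for every deterministic online algorithm, eight machines.) For m = 8 machines in the uniform profit case, for every deterministic online algorithm A there exists an instance σ with OPT(σ) ≥ (28/25) · V_A(σ). -/
open MeasureTheory

/-- The time axis `[0, 7]` is cut at `2` and `5`.  A pair of Booleans says whether the parts to the
left of `2` and to the right of `5` are covered; `(false, false)` stands for the empty set, and
every other pair covers `[2, 5]` as well. -/
abbrev Cover := Bool × Bool

namespace Cover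

def union (p q : Cover) : Cover := (p.1 || q.1, p.2 || q.2)

def length : Cover → ℕ
  | (false, false) => 0
  | (true, true) => 7
  | _ => 5

noncomputable def interval (p : Cover) : ℝ × ℝ :=
  (if p.1 then 0 else 2, if p.2 then 7 else 5)

def toSet (p : Cover) : Set ℝ :=
  if p = (false, false) then ∅ else Set.Icc p.interval.1 p.interval.2

lemma interval_lt (p : Cover) : p.interval.1 < p.interval.2 := by
  rcases p with ⟨_ | _, _ | _⟩ <;> norm_num [interval]

lemma toSet_union (p q : Cover) : (p.union q).toSet = p.toSet ∪ q.toSet := by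
  rcases p with ⟨_ | _, _ | _⟩ <;> rcases q with ⟨_ | _, _ | _⟩ <;> ext z <;>
    simp [union, toSet, interval] <;> grind

lemma volume_toSet (p : Cover) : (volume p.toSet).toReal = p.length := by
  rcases p with ⟨_ | _, _ | _⟩ <;> norm_num [toSet, interval, length]

end Cover

/-- The parts covered on each machine after the first `n` jobs of the sequence `J` have been placed
according to `x`. -/
def coverAfter {m : ℕ} (J : ℕ → Cover) (x : ℕ → Fin m) : ℕ → Fin m → Cover
  | 0 => fun _ => (false, false)
  | n + 1 => Function.update (coverAfter J x n) (x n) ((coverAfter J x n (x n)).union (J n))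

lemma iUnion_interval_eq_toSet {m : ℕ} (J : ℕ → Cover) (hJ : ∀ n, J n ≠ (false, false))
    (x : ℕ → Fin m) (n : ℕ) (a : Fin m) :
    ⋃ i : Fin n, ⋃ (_ : x i = a), Set.Icc (J i).interval.1 (J i).interval.2 =
      (coverAfter J x n a).toSet := by
  induction n with
  | zero => simp [coverAfter, Cover.toSet]
  | succ n ih =>
    have hsplit : ⋃ i : Fin (n + 1), ⋃ (_ : x i = a),
        Set.Icc (J i).interval.1 (J i).interval.2 =
        (⋃ i : Fin n, ⋃ (_ : x i = a), Set.Icc (J i).interval.1 (J i).interval.2) ∪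
          ⋃ (_ : x n = a), Set.Icc (J n).interval.1 (J n).interval.2 := by
      ext z
      simp only [Set.mem_iUnion, Set.mem_union, Fin.exists_fin_succ', Fin.val_castSucc, Fin.val_last]
    rw [hsplit, ih]
    by_cases h : x n = a
    · subst h
      have hset : (J n).toSet = Set.Icc (J n).interval.1 (J n).interval.2 := if_neg (hJ n)
      simp [coverAfter, Cover.toSet_union, hset]
    · simp [coverAfter, h, Function.update_of_ne (Ne.symm h)]

def totalCover {m : ℕ} (s : Fin m → Cover) : ℕ := ∑ a, (s a).length

lemma profit_eq_totalCover {m : ℕ} (J : ℕ → Cover) (hJ : ∀ n, J n ≠ (false, false))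
    (x : ℕ → Fin m) (n : ℕ) :
    profit (fun i : Fin n => (J i).interval) (fun i => x i) = totalCover (coverAfter J x n) := by
  simp only [profit, totalCover, iUnion_interval_eq_toSet J hJ, Cover.volume_toSet, Nat.cast_sum]

lemma totalCover_le_opt {m : ℕ} (J : ℕ → Cover) (hJ : ∀ n, J n ≠ (false, false))
    (y : ℕ → Fin m) (n : ℕ) :
    (totalCover (coverAfter J y n) : ℝ) ≤ opt m (fun i : Fin n => (J i).interval) := by
  rw [← profit_eq_totalCover J hJ]
  exact le_ciSup (f := fun f : Fin n → Fin m => profit (fun i : Fin n => (J i).interval) f)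
    (Set.finite_range _).bddAbove _

/-- The machine which the algorithm `A` chooses for the `n`-th job of the sequence `J`. -/
noncomputable def response {m : ℕ} (A : List (ℝ × ℝ) → Fin m) (J : ℕ → Cover) (n : ℕ) : Fin m :=
  A (List.ofFn fun i : Fin (n + 1) => (J i).interval)

lemma inducedPlacement_eq_response {m : ℕ} (A : List (ℝ × ℝ) → Fin m) (J : ℕ → Cover) (n : ℕ) :
    inducedPlacement m A (fun i : Fin n => (J i).interval) = fun i : Fin n => response A J i := by
  funext i
  unfold inducedPlacement response
  congr 1
  apply List.ext_getElem
  · simp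
  · intro k _ _
    simp only [List.getElem_take, List.getElem_ofFn]

lemma coverAfter_response_congr {m : ℕ} (A : List (ℝ × ℝ) → Fin m) {J K : ℕ → Cover} {n : ℕ}
    (h : ∀ i < n, J i = K i) :
    coverAfter J (response A J) n = coverAfter K (response A K) n := by
  induction n with
  | zero => rfl
  | succ n ih =>
    have hx : response A J n = response A K n := by
      unfold response
      congr 2
      funext i
      rw [h i i.2]
    simp only [coverAfter, ih fun i hi => h i (hi.trans n.lt_succ_self), hx, h n n.lt_succ_self]

/-- `HasCounts s l r f`: under `s`, exactly `l` machines cover only `[0, 5]`, `r` only `[2, 7]`,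
and `f` all of `[0, 7]`, the remaining ones being empty. -/
structure HasCounts {m : ℕ} (s : Fin m → Cover) (l r f : ℕ) : Prop where
  left : (∑ a, if s a = (true, false) then 1 else 0) = l
  right : (∑ a, if s a = (false, true) then 1 else 0) = r
  full : (∑ a, if s a = (true, true) then 1 else 0) = f

lemma HasCounts.add_le {m : ℕ} {s : Fin m → Cover} {l r f : ℕ} (h : HasCounts s l r f) :
    l + r + f ≤ m := by
  rw [← h.left, ← h.right, ← h.full, ← Finset.sum_add_distrib, ← Finset.sum_add_distrib]
  calc _ ≤ ∑ _a : Fin m, 1 := Finset.sum_le_sum fun a _ => by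
        rcases s a with ⟨_ | _, _ | _⟩ <;> simp
    _ = m := by simp

lemma HasCounts.totalCover_eq {m : ℕ} {s : Fin m → Cover} {l r f : ℕ} (h : HasCounts s l r f) :
    totalCover s = 5 * l + 5 * r + 7 * f := by
  rw [← h.left, ← h.right, ← h.full, Finset.mul_sum, Finset.mul_sum, Finset.mul_sum,
    ← Finset.sum_add_distrib, ← Finset.sum_add_distrib]
  refine Finset.sum_congr rfl fun a _ => ?_
  rcases s a with ⟨_ | _, _ | _⟩ <;> simp [Cover.length]

lemma sum_update_add {m : ℕ} (s : Fin m → Cover) (x : Fin m) (u : Cover) (g : Cover → ℕ) :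
    (∑ a, g (Function.update s x u a)) + g (s x) = (∑ a, g (s a)) + g u := by
  rw [← Finset.add_sum_erase _ _ (Finset.mem_univ x),
    ← Finset.add_sum_erase _ (fun a => g (s a)) (Finset.mem_univ x)]
  have : ∑ a ∈ Finset.univ.erase x, g (Function.update s x u a) =
      ∑ a ∈ Finset.univ.erase x, g (s a) :=
    Finset.sum_congr rfl fun a ha => by rw [Function.update_of_ne (Finset.ne_of_mem_erase ha)]
  rw [this, Function.update_self]
  omega

lemma HasCounts.of_update {m : ℕ} {s : Fin m → Cover} {l r f l' r' f' : ℕ} {x : Fin m} {u : Cover}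
    (h : HasCounts s l r f) (h' : HasCounts (Function.update s x u) l' r' f') :
    l' + (if s x = (true, false) then 1 else 0) = l + (if u = (true, false) then 1 else 0) ∧
    r' + (if s x = (false, true) then 1 else 0) = r + (if u = (false, true) then 1 else 0) ∧
    f' + (if s x = (true, true) then 1 else 0) = f + (if u = (true, true) then 1 else 0) := by
  rw [← h.left, ← h.right, ← h.full, ← h'.left, ← h'.right, ← h'.full]
  exact ⟨sum_update_add s x u fun p => if p = (true, false) then 1 else 0,
    sum_update_add s x u fun p => if p = (false, true) then 1 else 0,
    sum_update_add s x u fun p => if p = (true, true) then 1 else 0⟩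

section Step

variable {m : ℕ} {J : ℕ → Cover} {x : ℕ → Fin m} {n l r f : ℕ}

lemma HasCounts.step_left (h : HasCounts (coverAfter J x n) l r f) (hJ : J n = (true, false)) :
    ∃ l' r' f', HasCounts (coverAfter J x (n + 1)) l' r' f' ∧
      ((l' = l + 1 ∧ r' = r ∧ f' = f) ∨ (l' = l ∧ r' = r ∧ f' = f) ∨
        (l' = l ∧ r' + 1 = r ∧ f' = f + 1)) := by
  obtain ⟨l', r', f', h'⟩ : ∃ l' r' f', HasCounts (coverAfter J x (n + 1)) l' r' f' :=
    ⟨_, _, _, ⟨rfl, rfl, rfl⟩⟩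
  refine ⟨l', r', f', h', ?_⟩
  have key := h.of_update h'
  rw [hJ] at key
  rcases hs : coverAfter J x n (x n) with ⟨_ | _, _ | _⟩ <;>
    simp [hs, Cover.union] at key <;> omega

lemma HasCounts.step_right (h : HasCounts (coverAfter J x n) l r f) (hJ : J n = (false, true)) :
    ∃ l' r' f', HasCounts (coverAfter J x (n + 1)) l' r' f' ∧
      ((l' = l ∧ r' = r + 1 ∧ f' = f) ∨ (l' = l ∧ r' = r ∧ f' = f) ∨
        (l' + 1 = l ∧ r' = r ∧ f' = f + 1)) := by
  obtain ⟨l', r', f', h'⟩ : ∃ l' r' f', HasCounts (coverAfter J x (n + 1)) l' r' f' :=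
    ⟨_, _, _, ⟨rfl, rfl, rfl⟩⟩
  refine ⟨l', r', f', h', ?_⟩
  have key := h.of_update h'
  rw [hJ] at key
  rcases hs : coverAfter J x n (x n) with ⟨_ | _, _ | _⟩ <;>
    simp [hs, Cover.union] at key <;> omega

lemma HasCounts.step_full (h : HasCounts (coverAfter J x n) l r f) (hJ : J n = (true, true)) :
    ∃ l' r' f', HasCounts (coverAfter J x (n + 1)) l' r' f' ∧
      ((l' = l ∧ r' = r ∧ f' = f + 1) ∨ (l' = l ∧ r' = r ∧ f' = f) ∨
        (l' + 1 = l ∧ r' = r ∧ f' = f + 1) ∨ (l' = l ∧ r' + 1 = r ∧ f' = f + 1)) := by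
  obtain ⟨l', r', f', h'⟩ : ∃ l' r' f', HasCounts (coverAfter J x (n + 1)) l' r' f' :=
    ⟨_, _, _, ⟨rfl, rfl, rfl⟩⟩
  refine ⟨l', r', f', h', ?_⟩
  have key := h.of_update h'
  rw [hJ] at key
  rcases hs : coverAfter J x n (x n) with ⟨_ | _, _ | _⟩ <;>
    simp [hs, Cover.union] at key <;> omega

end Step

/-- Three copies of `[0, 5]`, three of `[2, 7]`, then copies of `[0, 7]`. -/
def threeThree (n : ℕ) : Cover :=
  if n < 3 then (true, false) else if n < 6 then (false, true) else (true, true)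

/-- Like `threeThree`, with one more copy of `[0, 5]` and of `[2, 7]` after the first six jobs. -/
def fourFour (n : ℕ) : Cover :=
  if n < 3 then (true, false) else if n < 6 then (false, true) else
    if n = 6 then (true, false) else if n = 7 then (false, true) else (true, true)

lemma threeThree_ne (n : ℕ) : threeThree n ≠ (false, false) := by
  unfold threeThree; split_ifs <;> simp

lemma fourFour_ne (n : ℕ) : fourFour n ≠ (false, false) := by
  unfold fourFour; split_ifs <;> simp

/-- A good placement of the first `n` jobs of `threeThree`: beyond eight jobs, each further copy of
`[0, 7]` takes the machine of a copy of `[2, 7]`, which joins a copy of `[0, 5]`. -/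
def threeThreePlacement (n i : ℕ) : Fin 8 :=
  Fin.ofNat 8 (if 8 ≤ i then i - 5 else if 3 ≤ i ∧ i + 5 < n then i - 3 else i)

/-- The analogue of `threeThreePlacement` for `fourFour`. -/
def fourFourPlacement (n i : ℕ) : Fin 8 :=
  Fin.ofNat 8 (if i = 11 then 7 else if 8 ≤ i then i - 5 else
    if i = 7 ∧ n = 12 then 6 else if 3 ≤ i ∧ i < 6 ∧ i + 5 < n then i - 3 else i)

lemma totalCover_threeThreePlacement {n : ℕ} (hn : n < 12) :
    totalCover (coverAfter threeThree (threeThreePlacement n) n) =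
      [0, 5, 10, 15, 20, 25, 30, 37, 44, 48, 52, 56].getD n 0 := by
  decide +revert +kernel

lemma totalCover_fourFourPlacement {n : ℕ} (hn : n < 13) :
    totalCover (coverAfter fourFour (fourFourPlacement n) n) =
      [0, 5, 10, 15, 20, 25, 30, 35, 40, 44, 48, 52, 56].getD n 0 := by
  decide +revert +kernel

/-- Lower bound for every deterministic online algorithm on eight machines:
there is an instance with `OPT(σ) ≥ (28/25) · V_A(σ)`. -/
theorem online_lower_bound_eight_machines (A : List (ℝ × ℝ) → Fin 8) :
    ∃ (n : ℕ), 0 < n ∧ ∃ jobs : Fin n → ℝ × ℝ,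
      (∀ i, (jobs i).1 < (jobs i).2) ∧
      (28 / 25) * profit jobs (inducedPlacement 8 A jobs) ≤ opt 8 jobs := by
  by_contra! H
  have good (J : ℕ → Cover) (hJ : ∀ n, J n ≠ (false, false)) (y : ℕ → Fin 8) (n l r f : ℕ)
      (hn : 0 < n) (hc : HasCounts (coverAfter J (response A J) n) l r f) :
      25 * totalCover (coverAfter J y n) < 28 * (5 * l + 5 * r + 7 * f) := by
    have h := H n hn (fun i => (J i).interval) fun i => (J i).interval_lt
    rw [inducedPlacement_eq_response, profit_eq_totalCover J hJ, hc.totalCover_eq] at h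
    have h' := (totalCover_le_opt J hJ y n).trans_lt h
    rify
    push_cast at h'
    linarith
  have goodThree (n l r f : ℕ) (hn : 0 < n) (hn' : n < 12)
      (hc : HasCounts (coverAfter threeThree (response A threeThree) n) l r f) :=
    totalCover_threeThreePlacement hn' ▸ good _ threeThree_ne (threeThreePlacement n) n l r f hn hc
  have goodFour (n l r f : ℕ) (hn : 0 < n) (hn' : n < 13)
      (hc : HasCounts (coverAfter fourFour (response A fourFour) n) l r f) :=
    totalCover_fourFourPlacement hn' ▸ good _ fourFour_ne (fourFourPlacement n) n l r f hn hc
  have h0 : HasCounts (coverAfter threeThree (response A threeThree) 0) 0 0 0 := by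
    constructor <;> simp [coverAfter]
  obtain ⟨l1, r1, f1, h1, t1⟩ := h0.step_left (by simp [threeThree])
  obtain ⟨l2, r2, f2, h2, t2⟩ := h1.step_left (by simp [threeThree])
  obtain ⟨l3, r3, f3, h3, t3⟩ := h2.step_left (by simp [threeThree])
  have g1 := goodThree _ _ _ _ (by norm_num) (by norm_num) h1
  have g2 := goodThree _ _ _ _ (by norm_num) (by norm_num) h2
  have g3 := goodThree _ _ _ _ (by norm_num) (by norm_num) h3
  simp at g1 g2 g3
  have e3 : l3 = 3 ∧ r3 = 0 ∧ f3 = 0 := by omega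
  clear t1 t2 t3 g1 g2 g3
  obtain ⟨l4, r4, f4, h4, t4⟩ := h3.step_right (by simp [threeThree])
  obtain ⟨l5, r5, f5, h5, t5⟩ := h4.step_right (by simp [threeThree])
  obtain ⟨l6, r6, f6, h6, t6⟩ := h5.step_right (by simp [threeThree])
  have g4 := goodThree _ _ _ _ (by norm_num) (by norm_num) h4
  have g5 := goodThree _ _ _ _ (by norm_num) (by norm_num) h5
  have g6 := goodThree _ _ _ _ (by norm_num) (by norm_num) h6
  simp at g4 g5 g6
  have e6 : (l6 = 3 ∧ r6 = 3 ∧ f6 = 0) ∨ (l6 = 2 ∧ r6 = 2 ∧ f6 = 1) := by omega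
  clear t4 t5 t6 g4 g5 g6
  rcases e6 with e6 | e6
  · obtain ⟨l7, r7, f7, h7, t7⟩ := h6.step_full (by simp [threeThree])
    have g7 := goodThree _ _ _ _ (by norm_num) (by norm_num) h7
    have b7 := h7.add_le
    simp at g7
    have e7 : l7 = 3 ∧ r7 = 3 ∧ f7 = 1 := by omega
    clear t7 g7
    obtain ⟨l8, r8, f8, h8, t8⟩ := h7.step_full (by simp [threeThree])
    have g8 := goodThree _ _ _ _ (by norm_num) (by norm_num) h8
    have b8 := h8.add_le
    simp at g8
    have e8 : l8 = 3 ∧ r8 = 3 ∧ f8 = 2 := by omega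
    clear t8 g8
    obtain ⟨l9, r9, f9, h9, t9⟩ := h8.step_full (by simp [threeThree])
    have g9 := goodThree _ _ _ _ (by norm_num) (by norm_num) h9
    have b9 := h9.add_le
    simp at g9
    have e9 : l9 + r9 + f9 = 8 ∧ f9 ≤ 3 := by omega
    clear t9 g9
    obtain ⟨l10, r10, f10, h10, t10⟩ := h9.step_full (by simp [threeThree])
    have g10 := goodThree _ _ _ _ (by norm_num) (by norm_num) h10
    have b10 := h10.add_le
    simp at g10
    have e10 : l10 + r10 + f10 = 8 ∧ f10 ≤ 4 := by omega
    clear t10 g10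
    obtain ⟨l11, r11, f11, h11, t11⟩ := h10.step_full (by simp [threeThree])
    have g11 := goodThree _ _ _ _ (by norm_num) (by norm_num) h11
    have b11 := h11.add_le
    simp at g11
    omega
  · have agree : ∀ i < 6, threeThree i = fourFour i := by
      intro i hi
      simp [threeThree, fourFour, hi]
    rw [coverAfter_response_congr A agree] at h6
    obtain ⟨l7, r7, f7, h7, t7⟩ := h6.step_left (by simp [fourFour])
    have g7 := goodFour _ _ _ _ (by norm_num) (by norm_num) h7
    have b7 := h7.add_le
    simp at g7
    have e7 : l7 = 3 ∧ r7 = 2 ∧ f7 = 1 := by omega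
    clear t7 g7
    obtain ⟨l8, r8, f8, h8, t8⟩ := h7.step_right (by simp [fourFour])
    have g8 := goodFour _ _ _ _ (by norm_num) (by norm_num) h8
    have b8 := h8.add_le
    simp at g8
    have e8 : l8 = 3 ∧ r8 = 3 ∧ f8 = 1 := by omega
    clear t8 g8
    obtain ⟨l9, r9, f9, h9, t9⟩ := h8.step_full (by simp [fourFour])
    have g9 := goodFour _ _ _ _ (by norm_num) (by norm_num) h9
    have b9 := h9.add_le
    simp at g9
    have e9 : l9 = 3 ∧ r9 = 3 ∧ f9 = 2 := by omega
    clear t9 g9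
    obtain ⟨l10, r10, f10, h10, t10⟩ := h9.step_full (by simp [fourFour])
    have g10 := goodFour _ _ _ _ (by norm_num) (by norm_num) h10
    have b10 := h10.add_le
    simp at g10
    have e10 : l10 + r10 + f10 = 8 ∧ f10 ≤ 3 := by omega
    clear t10 g10
    obtain ⟨l11, r11, f11, h11, t11⟩ := h10.step_full (by simp [fourFour])
    have g11 := goodFour _ _ _ _ (by norm_num) (by norm_num) h11
    have b11 := h11.add_le
    simp at g11
    have e11 : l11 + r11 + f11 = 8 ∧ f11 ≤ 4 := by omega
    clear t11 g11
    obtain ⟨l12, r12, f12, h12, t12⟩ := h11.step_full (by simp [fourFour])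
    have g12 := goodFour _ _ _ _ (by norm_num) (by norm_num) h12
    have b12 := h12.add_le
    simp at g12
    omega
end

section
/- (Uniform lower bound for every even number of machines.) For every even m ≥ 2 in the uniform profit case, for every deterministic online algorithm A on m machines there exists an instance σ with OPT(σ) ≥ (11/10) · V_A(σ); in particular, no deterministic online algorithm on an even number of machines has competitive ratio below 11/10. (The adversary first presents m/2 copies of [0,1] and m/2 copies of [2,3]; depending on how many machines receive jobs from both groups, it then presents either m/2 copies of [0,3], or m/2 copies of [0,2] followed by m/2 copies of [1,3].) -/
open MeasureTheory

/-- The number of jobs with index in `s` that the placement `F` puts on machine `a`. -/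
def jobCount {m : ℕ} (F : ℕ → Fin m) (s : Finset ℕ) (a : Fin m) : ℕ :=
  (s.filter fun i => F i = a).card

lemma sum_jobCount {m : ℕ} (F : ℕ → Fin m) (s : Finset ℕ) :
    ∑ a, (jobCount F s a : ℝ) = s.card := by
  rw [Finset.card_eq_sum_card_fiberwise (f := F) (t := Finset.univ) (by simp)]
  simp [jobCount]

lemma jobCount_pos {m : ℕ} {F : ℕ → Fin m} {s : Finset ℕ} {a : Fin m} {i : ℕ}
    (hi : i ∈ s) (h : F i = a) : 0 < jobCount F s a :=
  Finset.card_pos.2 ⟨i, by simp [hi, h]⟩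

lemma jobCount_congr {m : ℕ} {F G : ℕ → Fin m} {s : Finset ℕ} (h : ∀ i ∈ s, F i = G i)
    (a : Fin m) : jobCount F s a = jobCount G s a := by
  unfold jobCount
  congr 1
  refine Finset.filter_congr fun i hi => ?_
  rw [h i hi]

/-- The indicator that machine `a` receives jobs with indices in both `[0, k)` and
`[k, 2k)`. -/
def isMixed {m : ℕ} (F : ℕ → Fin m) (k : ℕ) (a : Fin m) : ℕ :=
  if 0 < jobCount F (Finset.Ico 0 k) a ∧ 0 < jobCount F (Finset.Ico k (k + k)) a then 1 else 0

/-- The set of times at which machine `a` is busy. -/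
def busy {m : ℕ} (J : ℕ → ℝ × ℝ) (F : ℕ → Fin m) (n : ℕ) (a : Fin m) : Set ℝ :=
  ⋃ i : Fin n, ⋃ (_ : F i = a), Set.Icc (J i).1 (J i).2

lemma profit_eq_sum_busy {m : ℕ} (J : ℕ → ℝ × ℝ) (F : ℕ → Fin m) (n : ℕ) :
    profit (fun i : Fin n => J i) (fun i => F i) = ∑ a, volume.real (busy J F n a) := rfl

lemma busy_subset_Icc {m : ℕ} {J : ℕ → ℝ × ℝ} (hJ : ∀ i, 0 ≤ (J i).1 ∧ (J i).2 ≤ 3)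
    (F : ℕ → Fin m) (n : ℕ) (a : Fin m) : busy J F n a ⊆ Set.Icc 0 3 :=
  Set.iUnion_subset fun i => Set.iUnion_subset fun _ =>
    Set.Icc_subset_Icc (hJ i).1 (hJ i).2

lemma Icc_subset_busy {m n : ℕ} {J : ℕ → ℝ × ℝ} {F : ℕ → Fin m} {a : Fin m} {i : ℕ}
    (hi : i < n) (h : F i = a) : Set.Icc (J i).1 (J i).2 ⊆ busy J F n a :=
  Set.subset_iUnion₂_of_subset (⟨i, hi⟩ : Fin n) h subset_rfl

lemma volume_busy_le_three {m : ℕ} {J : ℕ → ℝ × ℝ} (hJ : ∀ i, 0 ≤ (J i).1 ∧ (J i).2 ≤ 3)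
    (F : ℕ → Fin m) (n : ℕ) (a : Fin m) : volume.real (busy J F n a) ≤ 3 := by
  have h := measureReal_mono (μ := volume) (busy_subset_Icc hJ F n a)
    (by simp [Real.volume_Icc])
  simpa [measureReal_def, Real.volume_Icc] using h

lemma volume_busy_le {m k n : ℕ} {J : ℕ → ℝ × ℝ} {w : ℝ}
    (h₀ : ∀ i < k, J i = (0, 1)) (h₁ : ∀ i, k ≤ i → i < k + k → J i = (2, 3))
    (hw : ∀ i, k + k ≤ i → 0 ≤ (J i).2 - (J i).1 ∧ (J i).2 - (J i).1 ≤ w)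
    (F : ℕ → Fin m) (a : Fin m) :
    volume.real (busy J F n a) ≤
      (if 0 < jobCount F (Finset.Ico 0 k) a then 1 else 0) +
      (if 0 < jobCount F (Finset.Ico k (k + k)) a then 1 else 0) +
      jobCount F (Finset.Ico (k + k) n) a * w := by
  set S : Set ℝ := if 0 < jobCount F (Finset.Ico 0 k) a then Set.Icc 0 1 else ∅ with hS
  set T : Set ℝ := if 0 < jobCount F (Finset.Ico k (k + k)) a then Set.Icc 2 3 else ∅ with hT
  set R := (Finset.Ico (k + k) n).filter fun i => F i = a with hR
  have hsub : busy J F n a ⊆ S ∪ T ∪ ⋃ i ∈ R, Set.Icc (J i).1 (J i).2 := by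
    refine Set.iUnion_subset fun i => Set.iUnion_subset fun hi => ?_
    rcases lt_or_ge i.1 k with hk | hk
    · have : 0 < jobCount F (Finset.Ico 0 k) a := jobCount_pos (by simpa using hk) hi
      rw [h₀ _ hk, hS, if_pos this]
      exact Set.subset_union_left.trans Set.subset_union_left
    rcases lt_or_ge i.1 (k + k) with hkk | hkk
    · have : 0 < jobCount F (Finset.Ico k (k + k)) a := jobCount_pos (by simp [hk, hkk]) hi
      rw [h₁ _ hk hkk, hT, if_pos this]
      exact Set.subset_union_right.trans Set.subset_union_left
    · refine Set.Subset.trans ?_ Set.subset_union_right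
      exact Set.subset_iUnion₂_of_subset i.1 (by simp [hR, hkk, hi]) subset_rfl
  have hSv : volume.real S = if 0 < jobCount F (Finset.Ico 0 k) a then 1 else 0 := by
    rw [hS]; split_ifs <;> simp [measureReal_def, Real.volume_Icc]
  have hTv : volume.real T = if 0 < jobCount F (Finset.Ico k (k + k)) a then 1 else 0 := by
    rw [hT]; split_ifs <;> norm_num [measureReal_def, Real.volume_Icc]
  have hSf : volume S ≠ ⊤ := by
    rw [hS]; split_ifs <;> simp [Real.volume_Icc]
  have hTf : volume T ≠ ⊤ := by
    rw [hT]; split_ifs <;> simp [Real.volume_Icc]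
  have hRf : volume (⋃ i ∈ R, Set.Icc (J i).1 (J i).2) ≠ ⊤ :=
    (R.isCompact_biUnion fun _ _ => isCompact_Icc).measure_ne_top
  have hRv : volume.real (⋃ i ∈ R, Set.Icc (J i).1 (J i).2) ≤
      jobCount F (Finset.Ico (k + k) n) a * w := by
    refine (measureReal_biUnion_finset_le _ _).trans ?_
    refine (Finset.sum_le_card_nsmul _ _ w fun i hi => ?_).trans_eq ?_
    · have hi' : k + k ≤ i := (Finset.mem_Ico.1 (Finset.mem_filter.1 hi).1).1
      rw [measureReal_def, Real.volume_Icc, ENNReal.toReal_ofReal (hw i hi').1]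
      exact (hw i hi').2
    · simp [jobCount, hR]
  calc volume.real (busy J F n a)
      ≤ volume.real (S ∪ T ∪ ⋃ i ∈ R, Set.Icc (J i).1 (J i).2) :=
        measureReal_mono hsub (measure_union_ne_top (measure_union_ne_top hSf hTf) hRf)
    _ ≤ volume.real S + volume.real T + volume.real (⋃ i ∈ R, Set.Icc (J i).1 (J i).2) :=
        (measureReal_union_le _ _).trans (by gcongr; exact measureReal_union_le _ _)
    _ ≤ _ := by rw [hSv, hTv]; gcongr

/-- `k` copies of `[0,1]`, `k` copies of `[2,3]`, then copies of `[0,3]`. -/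
def longJobs (k i : ℕ) : ℝ × ℝ :=
  if i < k then (0, 1) else if i < k + k then (2, 3) else (0, 3)

/-- `k` copies of `[0,1]`, `k` copies of `[2,3]`, `k` copies of `[0,2]`, then copies of
`[1,3]`. -/
def overlappingJobs (k i : ℕ) : ℝ × ℝ :=
  if i < k then (0, 1) else if i < k + k then (2, 3) else
    if i < k + k + k then (0, 2) else (1, 3)

lemma profit_longJobs_le (k : ℕ) (F : ℕ → Fin (k + k)) :
    profit (fun i : Fin (k + k + k) => longJobs k i) (fun i => F i) ≤
      4 * k + ∑ a, (isMixed F k a : ℝ) := by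
  have hJ : ∀ i, 0 ≤ (longJobs k i).1 ∧ (longJobs k i).2 ≤ 3 := fun i => by
    unfold longJobs; split_ifs <;> norm_num
  have key : ∀ a, volume.real (busy (longJobs k) F (k + k + k) a) ≤
      1 + 2 * (jobCount F (Finset.Ico (k + k) (k + k + k)) a : ℝ) + isMixed F k a := by
    intro a
    have h3 := volume_busy_le_three hJ F (k + k + k) a
    have hl := volume_busy_le (n := k + k + k) (J := longJobs k) (w := 3) (k := k)
      (fun i hi => by simp [longJobs, hi])
      (fun i h h' => by simp [longJobs, h', not_lt.2 h])
      (fun i h => by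
        have : ¬ i < k := by omega
        simp [longJobs, this, not_lt.2 h]) F a
    unfold isMixed
    rcases Nat.eq_zero_or_pos (jobCount F (Finset.Ico (k + k) (k + k + k)) a) with h | h
    · rw [h] at hl ⊢
      split_ifs at hl ⊢ <;> simp_all <;> linarith
    · have h' : (1 : ℝ) ≤ jobCount F (Finset.Ico (k + k) (k + k + k)) a := by exact_mod_cast h
      have : (0 : ℝ) ≤ ((if 0 < jobCount F (Finset.Ico 0 k) a ∧
        0 < jobCount F (Finset.Ico k (k + k)) a then 1 else 0 : ℕ) : ℝ) := Nat.cast_nonneg _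
      linarith
  rw [profit_eq_sum_busy]
  refine (Finset.sum_le_sum fun a _ => key a).trans_eq ?_
  rw [Finset.sum_add_distrib, Finset.sum_add_distrib, ← Finset.mul_sum, sum_jobCount]
  simp
  ring

lemma profit_overlappingJobs_le (k : ℕ) (F : ℕ → Fin (k + k)) :
    profit (fun i : Fin (k + k + k + k) => overlappingJobs k i) (fun i => F i) ≤
      6 * k - ∑ a, (isMixed F k a : ℝ) := by
  have hJ : ∀ i, 0 ≤ (overlappingJobs k i).1 ∧ (overlappingJobs k i).2 ≤ 3 := fun i => by
    unfold overlappingJobs; split_ifs <;> norm_num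
  have key : ∀ a, volume.real (busy (overlappingJobs k) F (k + k + k + k) a) ≤
      jobCount F (Finset.Ico 0 k) a + jobCount F (Finset.Ico k (k + k)) a +
      jobCount F (Finset.Ico (k + k) (k + k + k + k)) a + 1 - isMixed F k a := by
    intro a
    have h3 := volume_busy_le_three hJ F (k + k + k + k) a
    have hl := volume_busy_le (n := k + k + k + k) (J := overlappingJobs k) (w := 2) (k := k)
      (fun i hi => by simp [overlappingJobs, hi])
      (fun i h h' => by simp [overlappingJobs, h', not_lt.2 h])
      (fun i h => by
        have : ¬ i < k := by omega
        simp only [overlappingJobs, this, not_lt.2 h, if_false]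
        split_ifs <;> norm_num) F a
    unfold isMixed
    generalize jobCount F (Finset.Ico 0 k) a = b at *
    generalize jobCount F (Finset.Ico k (k + k)) a = c at *
    generalize jobCount F (Finset.Ico (k + k) (k + k + k + k)) a = d at *
    have hd : d = 0 ∨ d = 1 ∨ (2 : ℝ) ≤ d := by
      rcases d with _ | _ | d
      · simp
      · simp
      · right; right; push_cast; linarith [(Nat.cast_nonneg d : (0 : ℝ) ≤ d)]
    have hb : b = 0 ∨ 0 < b ∧ (1 : ℝ) ≤ b := by
      rcases Nat.eq_zero_or_pos b with h | h
      · exact .inl h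
      · exact .inr ⟨h, by exact_mod_cast h⟩
    have hc : c = 0 ∨ 0 < c ∧ (1 : ℝ) ≤ c := by
      rcases Nat.eq_zero_or_pos c with h | h
      · exact .inl h
      · exact .inr ⟨h, by exact_mod_cast h⟩
    rcases hb with rfl | ⟨hb, hb'⟩ <;> rcases hc with rfl | ⟨hc, hc'⟩ <;>
      rcases hd with rfl | rfl | hd <;> simp [*] at hl ⊢ <;> linarith
  rw [profit_eq_sum_busy]
  refine (Finset.sum_le_sum fun a _ => key a).trans_eq ?_
  rw [Finset.sum_sub_distrib, Finset.sum_add_distrib, Finset.sum_add_distrib,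
    Finset.sum_add_distrib, sum_jobCount, sum_jobCount, sum_jobCount]
  simp [add_assoc]
  ring

lemma profit_le_opt {m n : ℕ} (jobs : Fin n → ℝ × ℝ) (f : Fin n → Fin m) :
    profit jobs f ≤ opt m jobs :=
  le_ciSup (f := fun f => profit jobs f) (Set.finite_range _).bddAbove f

lemma five_mul_le_opt_longJobs (k : ℕ) (hk : 0 < k) :
    5 * (k : ℝ) ≤ opt (k + k) (fun i : Fin (k + k + k) => longJobs k i) := by
  have hJ : ∀ i, 0 ≤ (longJobs k i).1 ∧ (longJobs k i).2 ≤ 3 := fun i => by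
    unfold longJobs; split_ifs <;> norm_num
  let F : ℕ → Fin (k + k) := fun i =>
    if h : i < k then ⟨i, by omega⟩ else if h' : i - k < k + k then ⟨i - k, h'⟩ else ⟨0, by omega⟩
  refine le_trans ?_ (profit_le_opt _ fun i => F i)
  rw [profit_eq_sum_busy, Fin.sum_univ_add]
  have hf : ∀ a, volume (busy (longJobs k) F (k + k + k) a) ≠ ⊤ := fun a =>
    measure_ne_top_of_subset (busy_subset_Icc hJ _ _ _) (by simp [Real.volume_Icc])
  have h₂ : ∀ a : Fin k, 2 ≤ volume.real (busy (longJobs k) F (k + k + k) (Fin.castAdd k a)) := by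
    intro a
    have hs : Set.Icc (0 : ℝ) 1 ∪ Set.Icc 2 3 ⊆
        busy (longJobs k) F (k + k + k) (Fin.castAdd k a) := by
      refine Set.union_subset ?_ ?_
      · have := Icc_subset_busy (J := longJobs k) (F := F) (i := a) (n := k + k + k)
          (a := Fin.castAdd k a) (by omega) (by ext; simp [F])
        simpa [longJobs] using this
      · have := Icc_subset_busy (J := longJobs k) (F := F) (i := a + k) (n := k + k + k)
          (a := Fin.castAdd k a) (by omega) (by
            have : a.1 < k + k := by omega
            ext; simp [F, this])
        simpa [longJobs] using this
    have hd : Disjoint (Set.Icc (0 : ℝ) 1) (Set.Icc 2 3) :=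
      Set.disjoint_left.2 fun x hx hx' => by linarith [hx.2, hx'.1]
    have := measureReal_mono hs (hf _)
    rw [measureReal_union hd measurableSet_Icc (by simp) (by simp)] at this
    norm_num [measureReal_def, Real.volume_Icc] at this
    exact this
  have h₃ : ∀ a : Fin k, 3 ≤ volume.real (busy (longJobs k) F (k + k + k) (Fin.natAdd k a)) := by
    intro a
    have hs : Set.Icc (0 : ℝ) 3 ⊆ busy (longJobs k) F (k + k + k) (Fin.natAdd k a) := by
      have := Icc_subset_busy (J := longJobs k) (F := F) (i := k + k + a) (n := k + k + k)
        (a := Fin.natAdd k a) (by omega) (by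
          have h₁ : ¬ k + k + a.1 < k := by omega
          have h₂ : k + k + a.1 - k < k + k := by omega
          ext; simp only [F, h₁, h₂, dif_neg, dif_pos, not_false_eq_true, Fin.val_natAdd]; omega)
      have h₁ : ¬ k + k + a.1 < k := by omega
      simpa [longJobs, h₁] using this
    have := measureReal_mono hs (hf _)
    simpa [measureReal_def, Real.volume_Icc] using this
  have e₂ := Finset.card_nsmul_le_sum Finset.univ _ 2 fun a _ => h₂ a
  have e₃ := Finset.card_nsmul_le_sum Finset.univ _ 3 fun a _ => h₃ a
  simp only [Finset.card_univ, Fintype.card_fin, nsmul_eq_mul] at e₂ e₃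
  linarith

lemma six_mul_le_opt_overlappingJobs (k : ℕ) (hk : 0 < k) :
    6 * (k : ℝ) ≤ opt (k + k) (fun i : Fin (k + k + k + k) => overlappingJobs k i) := by
  have hJ : ∀ i, 0 ≤ (overlappingJobs k i).1 ∧ (overlappingJobs k i).2 ≤ 3 := fun i => by
    unfold overlappingJobs; split_ifs <;> norm_num
  let F : ℕ → Fin (k + k) := fun i =>
    if h : i < k + k then ⟨i, h⟩ else if h : i < k + k + k then ⟨i - k, by omega⟩ else
      if h : i - (k + k + k) < k + k then ⟨i - (k + k + k), h⟩ else ⟨0, by omega⟩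
  refine le_trans ?_ (profit_le_opt _ fun i => F i)
  rw [profit_eq_sum_busy]
  have hf : ∀ a, volume (busy (overlappingJobs k) F (k + k + k + k) a) ≠ ⊤ := fun a =>
    measure_ne_top_of_subset (busy_subset_Icc hJ _ _ _) (by simp [Real.volume_Icc])
  have h₃ : ∀ a, 3 ≤ volume.real (busy (overlappingJobs k) F (k + k + k + k) a) := by
    intro a
    have hs : Set.Icc (0 : ℝ) 3 ⊆ busy (overlappingJobs k) F (k + k + k + k) a := by
      rcases lt_or_ge a.1 k with ha | ha
      · have s₁ := Icc_subset_busy (J := overlappingJobs k) (F := F) (i := a)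
          (n := k + k + k + k) (a := a) (by omega) (by ext; simp [F])
        have s₂ := Icc_subset_busy (J := overlappingJobs k) (F := F) (i := k + k + k + a)
          (n := k + k + k + k) (a := a) (by omega) (by
            have h₁ : ¬ k + k + k + a.1 < k + k := by omega
            ext; simp [F, h₁])
        have h₁ : ¬ k + k + k + a.1 < k := by omega
        have h₂ : ¬ k + k + k + a.1 < k + k := by omega
        simp only [overlappingJobs, ha, h₁, h₂, if_true, if_false,
          Nat.not_lt.2 (Nat.le_add_right _ _)] at s₁ s₂
        intro x hx
        rcases le_total x 1 with h | h
        · exact s₁ ⟨hx.1, h⟩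
        · exact s₂ ⟨h, hx.2⟩
      · have s₁ := Icc_subset_busy (J := overlappingJobs k) (F := F) (i := a)
          (n := k + k + k + k) (a := a) (by omega) (by ext; simp [F])
        have s₂ := Icc_subset_busy (J := overlappingJobs k) (F := F) (i := a + k)
          (n := k + k + k + k) (a := a) (by omega) (by
            have h₁ : ¬ a.1 + k < k + k := by omega
            ext; simp [F, h₁])
        have h₁ : ¬ a.1 < k := by omega
        have h₂ : ¬ a.1 + k < k + k := by omega
        simp only [overlappingJobs, h₁, h₂, if_true, if_false, a.2, add_lt_add_iff_right,
          Nat.not_lt.2 (Nat.le_add_left _ _)] at s₁ s₂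
        intro x hx
        rcases le_total x 2 with h | h
        · exact s₂ ⟨hx.1, h⟩
        · exact s₁ ⟨h, hx.2⟩
    have := measureReal_mono hs (hf _)
    simpa [measureReal_def, Real.volume_Icc] using this
  have e₃ := Finset.card_nsmul_le_sum Finset.univ _ 3 fun a _ => h₃ a
  simp only [Finset.card_univ, Fintype.card_fin, nsmul_eq_mul] at e₃
  push_cast at e₃
  linarith

/-- The machine on which the algorithm `A` puts the `i`-th job of the sequence `J`. -/
def onlinePlacement {m : ℕ} (A : List (ℝ × ℝ) → Fin m) (J : ℕ → ℝ × ℝ) (i : ℕ) : Fin m :=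
  A ((List.range (i + 1)).map J)

lemma inducedPlacement_eq_onlinePlacement {m : ℕ} (A : List (ℝ × ℝ) → Fin m)
    (J : ℕ → ℝ × ℝ) (n : ℕ) :
    inducedPlacement m A (fun i : Fin n => J i) = fun i : Fin n => onlinePlacement A J i := by
  funext i
  unfold inducedPlacement onlinePlacement
  congr 1
  apply List.ext_getElem
  · simp
  · intro j _ _
    simp

lemma onlinePlacement_congr {m : ℕ} (A : List (ℝ × ℝ) → Fin m) {J K : ℕ → ℝ × ℝ} {i : ℕ}
    (h : ∀ j ≤ i, J j = K j) : onlinePlacement A J i = onlinePlacement A K i := by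
  unfold onlinePlacement
  congr 1
  refine List.map_congr_left fun j hj => h j ?_
  have := List.mem_range.1 hj
  omega

lemma isMixed_congr {m k : ℕ} {F G : ℕ → Fin m} (h : ∀ i < k + k, F i = G i) (a : Fin m) :
    isMixed F k a = isMixed G k a := by
  unfold isMixed
  rw [jobCount_congr (G := G) (s := Finset.Ico 0 k) fun i hi => h i (by
      have := Finset.mem_Ico.1 hi; omega),
    jobCount_congr (G := G) (s := Finset.Ico k (k + k)) fun i hi => h i (by
      have := Finset.mem_Ico.1 hi; omega)]

/-- Uniform lower bound for every even number of machines: for every even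
`m ≥ 2` and every deterministic online algorithm `A` on `m` machines, there is
an instance with `OPT(σ) ≥ (11/10) · V_A(σ)`. -/
theorem online_lower_bound_even_machines (m : ℕ) (hm : 2 ≤ m) (hme : Even m)
    (A : List (ℝ × ℝ) → Fin m) :
    ∃ (n : ℕ), 0 < n ∧ ∃ jobs : Fin n → ℝ × ℝ,
      (∀ i, (jobs i).1 < (jobs i).2) ∧
      (11 / 10) * profit jobs (inducedPlacement m A jobs) ≤ opt m jobs := by
  obtain ⟨k, rfl⟩ := hme
  have hk : 0 < k := by omega
  have hcongr : ∑ a, (isMixed (onlinePlacement A (longJobs k)) k a : ℝ) =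
      ∑ a, (isMixed (onlinePlacement A (overlappingJobs k)) k a : ℝ) := by
    refine Finset.sum_congr rfl fun a _ => ?_
    rw [isMixed_congr fun i hi => onlinePlacement_congr A fun j hj => ?_]
    have : j < k + k := by omega
    simp [longJobs, overlappingJobs, this]
  have h₁ := profit_longJobs_le k (onlinePlacement A (longJobs k))
  have h₂ := profit_overlappingJobs_le k (onlinePlacement A (overlappingJobs k))
  rw [← hcongr] at h₂
  rcases le_total (11 * ∑ a, (isMixed (onlinePlacement A (longJobs k)) k a : ℝ)) (6 * k)
    with h | h
  · refine ⟨k + k + k, by omega, fun i => longJobs k i, fun i => ?_, ?_⟩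
    · dsimp only; unfold longJobs; split_ifs <;> norm_num
    · rw [inducedPlacement_eq_onlinePlacement]
      have := five_mul_le_opt_longJobs k hk
      linarith
  · refine ⟨k + k + k + k, by omega, fun i => overlappingJobs k i, fun i => ?_, ?_⟩
    · dsimp only; unfold overlappingJobs; split_ifs <;> norm_num
    · rw [inducedPlacement_eq_onlinePlacement]
      have := six_mul_le_opt_overlappingJobs k hk
      linarith
end
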